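/- arXiv:1009.1587 — 3 statements merged into one kernel-verified Lean document; each statement's English description precedes it below -/
import Mathlib

section
/- Let n ≥ 3 and let Ω ⊂ ℝⁿ be a nonempty bounded open set such that the exterior E := ℝⁿ \ closure(Ω) is connected. Let u : ℝⁿ → ℝ be continuous on ℝⁿ \ Ω, twice continuously differentiable on E with Δu ≤ 0 everywhere on E, and suppose u tends to 1 at infinity. Assume further that for every point x in the frontier of Ω and every neighborhood N of x there exists a point y ∈ N ∩ E with u(y) < u(x) (this encodes the strictly negative outward normal derivative of u coming from minimality of the boundary together with mean-convexity of ∂Ω). Then u(x) ≥ 1 for every x ∈ ℝⁿ \ Ω. -/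
open MeasureTheory Metric Filter

/-- The Laplacian of `f` at `x`: the trace of the second Fréchet derivative,
computed in the standard orthonormal basis of Euclidean space. -/
noncomputable def laplacian {n : ℕ} (f : EuclideanSpace ℝ (Fin n) → ℝ)
    (x : EuclideanSpace ℝ (Fin n)) : ℝ :=
  ∑ i : Fin n,
    iteratedFDeriv ℝ 2 f x ![EuclideanSpace.single i 1, EuclideanSpace.single i 1]

/-- The second derivative is nonnegative at a local minimum. -/
theorem deriv_deriv_nonneg_of_isLocalMin {g : ℝ → ℝ} {t : ℝ} (hmin : IsLocalMin g t)
    (hcont : ContinuousAt g t) : 0 ≤ deriv (deriv g) t := by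
  by_contra! hneg
  have hmax : IsLocalMax g t := isLocalMax_of_deriv_deriv_neg hneg hmin.deriv_eq_zero hcont
  have hconst : g =ᶠ[nhds t] fun _ => g t := by
    filter_upwards [hmin, hmax] with s h₁ h₂ using le_antisymm h₂ h₁
  have hzero : deriv (deriv g) t = 0 := by
    rw [hconst.deriv.deriv_eq]
    simp
  exact hneg.ne hzero

/-- If `u - ε‖·‖²` has a local minimum at `q`, then each pure second derivative of `u` at `q`
in a unit direction is at least `2 * ε`. -/
theorem two_mul_le_iteratedFDeriv_two_of_isLocalMin {F : Type*} [NormedAddCommGroup F]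
    [InnerProductSpace ℝ F] {u : F → ℝ} {q e : F} {ε : ℝ} (hu : ContDiffAt ℝ 2 u q)
    (he : ‖e‖ = 1) (hmin : IsLocalMin (fun x => u x - ε * ‖x‖ ^ 2) q) :
    2 * ε ≤ iteratedFDeriv ℝ 2 u q ![e, e] := by
  have hline (t : ℝ) : HasDerivAt (fun s : ℝ => q + s • e) e t := by
    simpa using ((hasDerivAt_id t).smul_const e).const_add q
  have htend : Tendsto (fun s : ℝ => q + s • e) (nhds 0) (nhds q) := by
    simpa using (hline 0).continuousAt.tendsto
  have hderiv : ∀ᶠ t in nhds (0 : ℝ),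
      HasDerivAt (fun s : ℝ => u (q + s • e) - ε * ‖q + s • e‖ ^ 2)
        (fderiv ℝ u (q + t • e) e - ε * (2 * inner ℝ (q + t • e) e)) t := by
    filter_upwards [htend.eventually (hu.eventually (by simp))] with t ht
    exact ((ht.differentiableAt (by simp)).hasFDerivAt.comp_hasDerivAt t (hline t)).sub
      ((hline t).norm_sq.const_mul ε)
  have hfd : HasFDerivAt (fderiv ℝ u) (fderiv ℝ (fderiv ℝ u) q) (q + (0 : ℝ) • e) := by
    rw [zero_smul, add_zero]
    exact ((hu.fderiv_right (m := 1) (by norm_num)).differentiableAt (by simp)).hasFDerivAt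
  have hderiv_fderiv : HasDerivAt (fun t : ℝ => fderiv ℝ u (q + t • e) e)
      (fderiv ℝ (fderiv ℝ u) q e e) 0 :=
    (ContinuousLinearMap.apply ℝ ℝ e).hasFDerivAt.comp_hasDerivAt (0 : ℝ)
      (hfd.comp_hasDerivAt (0 : ℝ) (hline 0))
  have hderiv_inner : HasDerivAt (fun t : ℝ => inner ℝ (q + t • e) e) (inner ℝ e e) 0 := by
    simpa using (hline 0).inner ℝ (hasDerivAt_const 0 e)
  have hderiv2 := hderiv_fderiv.fun_sub ((hderiv_inner.const_mul 2).const_mul ε)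
  have hmin' : IsLocalMin (fun s : ℝ => u (q + s • e) - ε * ‖q + s • e‖ ^ 2) 0 := by
    filter_upwards [htend.eventually hmin] with s hs
    simpa using hs
  have hnonneg := deriv_deriv_nonneg_of_isLocalMin hmin' hderiv.self_of_nhds.continuousAt
  have heq := EventuallyEq.deriv_eq (hderiv.mono fun t ht => ht.deriv)
  rw [heq, hderiv2.deriv, real_inner_self_eq_norm_sq, he] at hnonneg
  rw [iteratedFDeriv_two_apply]
  simp only [Matrix.cons_val_zero, Matrix.cons_val_one]
  linarith

/-- If the Laplacian of `u` is nonpositive at `q`, then `u - ε‖·‖²` has no local minimum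
there. -/
theorem not_isLocalMin_sub_mul_norm_sq {n : ℕ} (hn : 0 < n)
    {u : EuclideanSpace ℝ (Fin n) → ℝ} {q : EuclideanSpace ℝ (Fin n)} {ε : ℝ} (hε : 0 < ε)
    (hu : ContDiffAt ℝ 2 u q) (hlap : laplacian u q ≤ 0) :
    ¬ IsLocalMin (fun x => u x - ε * ‖x‖ ^ 2) q := by
  intro hmin
  have : Nonempty (Fin n) := ⟨⟨0, hn⟩⟩
  refine hlap.not_gt (Finset.sum_pos (fun i _ => ?_) Finset.univ_nonempty)
  exact (by positivity : 0 < 2 * ε).trans_le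
    (two_mul_le_iteratedFDeriv_two_of_isLocalMin hu (by simp) hmin)

/-- Weak minimum principle: a superharmonic function on an open part `U` of a compact set `C`
attains its minimum over `C` on `C \ U`. -/
theorem exists_isMinOn_mem_diff_of_laplacian_nonpos {n : ℕ} (hn : 0 < n)
    {u : EuclideanSpace ℝ (Fin n) → ℝ} {C U : Set (EuclideanSpace ℝ (Fin n))}
    (hC : IsCompact C) (hCne : C.Nonempty) (hU : IsOpen U) (hUC : U ⊆ C)
    (hcont : ContinuousOn u C) (hu : ContDiffOn ℝ 2 u U)
    (hlap : ∀ x ∈ U, laplacian u x ≤ 0) :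
    ∃ z ∈ C \ U, IsMinOn u C z := by
  obtain ⟨p, hpC, hp⟩ := hC.exists_isMinOn hCne hcont
  obtain ⟨R, hR⟩ := hC.isBounded.exists_norm_le
  have hmin (ε : ℝ) (hε : 0 < ε) : ∃ q ∈ C \ U, ∀ x ∈ C,
      u q - ε * ‖q‖ ^ 2 ≤ u x - ε * ‖x‖ ^ 2 := by
    obtain ⟨q, hqC, hq⟩ := hC.exists_isMinOn hCne
      (hcont.sub (by fun_prop : ContinuousOn (fun x => ε * ‖x‖ ^ 2) C))
    refine ⟨q, ⟨hqC, fun hqU => ?_⟩, fun x hx => hq hx⟩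
    have hUq : U ∈ nhds q := hU.mem_nhds hqU
    exact not_isLocalMin_sub_mul_norm_sq hn hε (hu.contDiffAt hUq) (hlap q hqU)
      (hq.isLocalMin (mem_of_superset hUq hUC))
  obtain ⟨q₁, hq₁, -⟩ := hmin 1 one_pos
  obtain ⟨z, hz, hzmin⟩ := (hC.diff hU).exists_isMinOn ⟨q₁, hq₁⟩ (hcont.mono Set.sdiff_subset)
  refine ⟨z, hz, fun x hx => (?_ : u z ≤ u p).trans (hp hx)⟩
  by_contra! hlt
  have hden : 0 < R ^ 2 + 1 := by positivity
  obtain ⟨q, hq, hqmin⟩ := hmin ((u z - u p) / (R ^ 2 + 1)) (div_pos (sub_pos.2 hlt) hden)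
  have hqz : u z ≤ u q := hzmin hq
  have hqR : ‖q‖ ^ 2 < R ^ 2 + 1 := by
    nlinarith [pow_le_pow_left₀ (norm_nonneg q) (hR q hq.1) 2]
  have hsmall : (u z - u p) / (R ^ 2 + 1) * ‖q‖ ^ 2 < u z - u p := by
    calc (u z - u p) / (R ^ 2 + 1) * ‖q‖ ^ 2
        < (u z - u p) / (R ^ 2 + 1) * (R ^ 2 + 1) :=
          mul_lt_mul_of_pos_left hqR (div_pos (sub_pos.2 hlt) hden)
      _ = u z - u p := div_mul_cancel₀ _ hden.ne'
  have hpos : 0 ≤ (u z - u p) / (R ^ 2 + 1) * ‖p‖ ^ 2 :=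
    mul_nonneg (div_pos (sub_pos.2 hlt) hden).le (sq_nonneg _)
  linarith [hqmin p hpC]

theorem stmt_0 (n : ℕ) (hn : 3 ≤ n)
    (Ω : Set (EuclideanSpace ℝ (Fin n)))
    (hΩne : Ω.Nonempty) (hΩopen : IsOpen Ω) (hΩbdd : Bornology.IsBounded Ω)
    (E : Set (EuclideanSpace ℝ (Fin n))) (hE : E = (closure Ω)ᶜ)
    (hEconn : IsConnected E)
    (u : EuclideanSpace ℝ (Fin n) → ℝ)
    (hu_cont : ContinuousOn u Ωᶜ)
    (hu_C2 : ContDiffOn ℝ 2 u E)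
    (hu_super : ∀ x ∈ E, laplacian u x ≤ 0)
    (hu_infty : ∀ ε > 0, ∃ M : ℝ, ∀ x : EuclideanSpace ℝ (Fin n),
      M ≤ ‖x‖ → |u x - 1| < ε)
    (hbdry : ∀ x ∈ frontier Ω, ∀ N ∈ nhds x, ∃ y ∈ N ∩ E, u y < u x) :
    ∀ x ∈ Ωᶜ, 1 ≤ u x := by
  intro x₀ hx₀
  by_contra! hlt
  obtain ⟨M, hM⟩ := hu_infty (1 - u x₀) (sub_pos.2 hlt)
  have hfar (x : EuclideanSpace ℝ (Fin n)) (hx : M ≤ ‖x‖) : u x₀ < u x := by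
    linarith [(abs_lt.1 (hM x hx)).1]
  have hEopen : IsOpen E := hE ▸ isClosed_closure.isOpen_compl
  have hEΩ : E ⊆ Ωᶜ := hE ▸ Set.compl_subset_compl.2 subset_closure
  have hx₀M : ‖x₀‖ ≤ M := by
    by_contra! h
    exact (hfar x₀ h.le).false
  obtain ⟨z, ⟨⟨hzM, hzΩ⟩, hzU⟩, hz⟩ := exists_isMinOn_mem_diff_of_laplacian_nonpos
    (u := u) (C := closedBall 0 M ∩ Ωᶜ) (U := E ∩ ball 0 M) (by omega)
    ((isCompact_closedBall 0 M).inter_right hΩopen.isClosed_compl)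
    ⟨x₀, mem_closedBall_zero_iff.2 hx₀M, hx₀⟩ (hEopen.inter isOpen_ball)
    (fun x hx => ⟨ball_subset_closedBall hx.2, hEΩ hx.1⟩)
    (hu_cont.mono Set.inter_subset_right) (hu_C2.mono Set.inter_subset_left)
    (fun x hx => hu_super x hx.1)
  have hzx₀ : u z ≤ u x₀ := hz ⟨mem_closedBall_zero_iff.2 hx₀M, hx₀⟩
  have hzball : z ∈ ball 0 M := by
    rw [mem_ball_zero_iff]
    by_contra! h
    exact (hfar z h).not_ge hzx₀
  have hzfr : z ∈ frontier Ω := by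
    rw [hΩopen.frontier_eq]
    refine ⟨?_, hzΩ⟩
    by_contra h
    exact hzU ⟨hE ▸ h, hzball⟩
  obtain ⟨y, ⟨hyball, hyE⟩, hyz⟩ := hbdry z hzfr _ (isOpen_ball.mem_nhds hzball)
  exact hyz.not_ge (hz ⟨ball_subset_closedBall hyball, hEΩ hyE⟩)
end

section
/- (Pólya–Szegő symmetrization theorem.) Let n ≥ 1 and 1 ≤ p < ∞. Let f : ℝⁿ → ℝ be a nonnegative Lipschitz function with compact support. Then there exists a nonnegative Lipschitz function f* : ℝⁿ → ℝ which is radial nonincreasing, such that: (i) for every t > 0, the Lebesgue measure of {x : f*(x) > t} equals the Lebesgue measure of {x : f(x) > t}; (ii) ∫_{ℝⁿ} f*(x)^p dx = ∫_{ℝⁿ} f(x)^p dx; and (iii) ∫_{ℝⁿ} ‖∇f*(x)‖^p dx ≤ ∫_{ℝⁿ} ‖∇f(x)‖^p dx. -/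
open MeasureTheory Metric Filter

/-- A function on Euclidean space is radial nonincreasing if it is of the form
`h(‖x‖)` for some `h` nonincreasing on `[0, ∞)`. -/
def RadialNonincreasing {n : ℕ} (f : EuclideanSpace ℝ (Fin n) → ℝ) : Prop :=
  ∃ h : ℝ → ℝ, (∀ a b : ℝ, 0 ≤ a → a ≤ b → h b ≤ h a) ∧
    ∀ x : EuclideanSpace ℝ (Fin n), f x = h ‖x‖

section PolyaSzego

open scoped ENNReal Pointwise Topology NNReal

theorem Real.volume_add_le_volume_add_of_isCompact {K L : Set ℝ} (hK : IsCompact K)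
    (hL : IsCompact L) (hK0 : K.Nonempty) (hL0 : L.Nonempty) :
    volume K + volume L ≤ volume (K + L) := by
  have h1 : volume ((fun x => x + sInf L) '' K) = volume K := by
    simp
  have h2 : volume ((fun x => sSup K + x) '' L) = volume L := by
    simp
  have hd : AEDisjoint volume ((fun x => x + sInf L) '' K) ((fun x => sSup K + x) '' L) := by
    refine measure_mono_null (t := {sSup K + sInf L}) ?_ (by simp)
    rintro z ⟨⟨x, hx, rfl⟩, ⟨y, hy, hxy⟩⟩
    have := le_csSup hK.bddAbove hx
    have := csInf_le hL.bddBelow hy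
    simp only at hxy
    simp only [Set.mem_singleton_iff]
    linarith
  rw [← h1, ← h2, ← measure_union₀ _ hd]
  · apply measure_mono
    rintro z (⟨x, hx, rfl⟩ | ⟨x, hx, rfl⟩)
    · exact Set.add_mem_add hx (hL.sInf_mem hL0)
    · exact Set.add_mem_add (hK.sSup_mem hK0) hx
  · exact (hL.image (by fun_prop)).measurableSet.nullMeasurableSet

theorem Real.volume_add_le_volume_add {A B : Set ℝ} (hA : MeasurableSet A)
    (hB : MeasurableSet B) (hA0 : A.Nonempty) (hB0 : B.Nonempty) :
    volume A + volume B ≤ volume (A + B) := by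
  obtain ⟨a, ha⟩ := hA0
  obtain ⟨b, hb⟩ := hB0
  rw [hA.measure_eq_iSup_isCompact, hB.measure_eq_iSup_isCompact]
  simp_rw [iSup_and']
  refine ENNReal.biSup_add_biSup_le' ⟨∅, by simp⟩ ⟨∅, by simp⟩ ?_
  rintro K ⟨hKA, hK⟩ L ⟨hLB, hL⟩
  calc volume K + volume L ≤ volume (insert a K) + volume (insert b L) := by
        gcongr <;> exact Set.subset_insert _ _
    _ ≤ volume (insert a K + insert b L) :=
        volume_add_le_volume_add_of_isCompact (hK.insert a) (hL.insert b)
          (Set.insert_nonempty _ _) (Set.insert_nonempty _ _)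
    _ ≤ volume (A + B) := by
        gcongr <;> exact Set.insert_subset ‹_› ‹_›

/-- A measure space with a vector space structure satisfies the Prékopa–Leindler inequality. -/
def PrekopaLeindler (E : Type*) [AddCommGroup E] [Module ℝ E] [MeasureSpace E] : Prop :=
  ∀ (a b : ℝ), 0 < a → 0 < b → a + b = 1 → ∀ f g h : E → ℝ≥0∞,
    Measurable f → Measurable g → Measurable h →
    (∀ x y, f x ^ a * g y ^ b ≤ h (a • x + b • y)) →
    (∫⁻ x, f x) ^ a * (∫⁻ x, g x) ^ b ≤ ∫⁻ x, h x

/-- Additive form of the one-dimensional Prékopa–Leindler inequality, for functions whose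
supremum equals `1`. -/
theorem lintegral_add_le_lintegral_of_superlevel {a b : ℝ} (ha : 0 < a) (hb : 0 < b)
    {f g h : ℝ → ℝ} (hf : Measurable f) (hg : Measurable g) (hh : Measurable h)
    (hf0 : ∀ x, 0 ≤ f x) (hg0 : ∀ x, 0 ≤ g x) (hh0 : ∀ x, 0 ≤ h x)
    (hf1 : ∀ x, f x ≤ 1) (hg1 : ∀ x, g x ≤ 1)
    (hf2 : ∀ t < 1, ∃ x, t < f x) (hg2 : ∀ t < 1, ∃ x, t < g x)
    (H : ∀ x y t, 0 ≤ t → t < f x → t < g y → t < h (a * x + b * y)) :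
    ENNReal.ofReal a * (∫⁻ x, .ofReal (f x)) + ENNReal.ofReal b * (∫⁻ x, .ofReal (g x)) ≤
      ∫⁻ x, .ofReal (h x) := by
  rw [lintegral_eq_lintegral_meas_lt _ (ae_of_all _ hf0) hf.aemeasurable,
    lintegral_eq_lintegral_meas_lt _ (ae_of_all _ hg0) hg.aemeasurable,
    lintegral_eq_lintegral_meas_lt _ (ae_of_all _ hh0) hh.aemeasurable,
    ← lintegral_const_mul' _ _ ENNReal.ofReal_ne_top,
    ← lintegral_const_mul' _ _ ENNReal.ofReal_ne_top]
  have meas : ∀ φ : ℝ → ℝ, Measurable fun t : ℝ => volume {x : ℝ | t < φ x} := fun φ =>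
    Antitone.measurable fun s t hst => measure_mono fun x hx => lt_of_le_of_lt hst hx
  rw [← lintegral_add_left ((meas f).const_mul _)]
  refine setLIntegral_mono (meas h) fun t ht => ?_
  rcases lt_or_ge t 1 with ht1 | ht1
  · have scale : ∀ (c : ℝ) (s : Set ℝ), 0 < c →
        ENNReal.ofReal c * volume s = volume (c • s) := fun c s hc => by
      simp [Measure.addHaar_smul, abs_of_pos hc]
    rw [scale a _ ha, scale b _ hb]
    refine (Real.volume_add_le_volume_add
      ((measurableSet_lt measurable_const hf).const_smul_of_ne_zero ha.ne')
      ((measurableSet_lt measurable_const hg).const_smul_of_ne_zero hb.ne')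
      (Set.Nonempty.smul_set (hf2 t ht1)) (Set.Nonempty.smul_set (hg2 t ht1))).trans
      (measure_mono ?_)
    rintro _ ⟨_, ⟨x, hx, rfl⟩, _, ⟨y, hy, rfl⟩, rfl⟩
    exact H x y t (le_of_lt ht) hx hy
  · have e1 : {x | t < f x} = ∅ := by
      ext x; simpa using (hf1 x).trans ht1
    have e2 : {x | t < g x} = ∅ := by
      ext x; simpa using (hg1 x).trans ht1
    simp [e1, e2]

theorem ENNReal.geom_mean_le_arith_mean {a b : ℝ} (ha : 0 < a) (hb : 0 < b) (hab : a + b = 1)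
    (x y : ℝ≥0∞) : x ^ a * y ^ b ≤ ENNReal.ofReal a * x + ENNReal.ofReal b * y := by
  have hpq : (a⁻¹).HolderConjugate b⁻¹ := Real.HolderConjugate.inv_inv ha hb hab
  have := ENNReal.young_inequality (x ^ a) (y ^ b) hpq
  rw [← ENNReal.rpow_mul, ← ENNReal.rpow_mul, mul_inv_cancel₀ ha.ne', mul_inv_cancel₀ hb.ne',
    ENNReal.rpow_one, ENNReal.rpow_one, ENNReal.ofReal_inv_of_pos ha,
    ENNReal.ofReal_inv_of_pos hb, div_eq_mul_inv, div_eq_mul_inv, inv_inv, inv_inv] at this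
  rwa [mul_comm x, mul_comm y] at this

/-- One-dimensional Prékopa–Leindler inequality for bounded functions. -/
theorem prekopaLeindler_real_of_bounded {a b : ℝ} (ha : 0 < a) (hb : 0 < b) (hab : a + b = 1)
    {f g h : ℝ → ℝ≥0∞} (hf : Measurable f) (hg : Measurable g) (hh : Measurable h)
    (hf1 : ⨆ x, f x ≠ ∞) (hg1 : ⨆ x, g x ≠ ∞)
    (H : ∀ x y, f x ^ a * g y ^ b ≤ h (a * x + b * y)) :
    (∫⁻ x, f x) ^ a * (∫⁻ x, g x) ^ b ≤ ∫⁻ x, h x := by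
  set A := ⨆ x, f x with hA
  set B := ⨆ x, g x with hB
  have fA : ∀ x, f x ≤ A := le_iSup f
  have gB : ∀ x, g x ≤ B := le_iSup g
  rcases eq_or_ne A 0 with hA0 | hA0
  · have : ∀ x, f x = 0 := fun x => by simpa [hA0] using fA x
    simp [this, ha]
  rcases eq_or_ne B 0 with hB0 | hB0
  · have : ∀ x, g x = 0 := fun x => by simpa [hB0] using gB x
    simp [this, hb]
  set C := A ^ a * B ^ b with hC
  have hC0 : C ≠ 0 := by simp [hC, hA0, hB0, hf1, hg1]
  have hC1 : C ≠ ∞ := ENNReal.mul_ne_top (by simp [hf1, ha.le]) (by simp [hg1, hb.le])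
  have fA' : ∀ x, f x / A ≤ 1 := fun x => ENNReal.div_le_of_le_mul (by simpa using fA x)
  have gB' : ∀ x, g x / B ≤ 1 := fun x => ENNReal.div_le_of_le_mul (by simpa using gB x)
  have fA'' : ∀ x, f x / A ≠ ∞ := fun x => ((fA' x).trans_lt ENNReal.one_lt_top).ne
  have gB'' : ∀ x, g x / B ≠ ∞ := fun x => ((gB' x).trans_lt ENNReal.one_lt_top).ne
  have hmin : ∀ x, min (h x / C) 1 ≠ ∞ := fun x =>
    ((min_le_right _ _).trans_lt ENNReal.one_lt_top).ne
  have attained : ∀ (φ : ℝ → ℝ≥0∞) (M : ℝ≥0∞), M = ⨆ x, φ x → M ≠ 0 → M ≠ ∞ →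
      (∀ x, φ x / M ≠ ∞) → ∀ t < 1, ∃ x, t < (φ x / M).toReal := by
    intro φ M hM hM0 hM1 hφ t ht
    rcases lt_or_ge t 0 with ht0 | ht0
    · exact ⟨0, ht0.trans_le ENNReal.toReal_nonneg⟩
    have : ENNReal.ofReal t * M < ⨆ x, φ x := by
      rw [← hM]
      calc ENNReal.ofReal t * M < 1 * M :=
            ENNReal.mul_lt_mul_left hM0 hM1 (by simpa using ht)
        _ = M := one_mul M
    obtain ⟨x, hx⟩ := lt_iSup_iff.1 this
    refine ⟨x, ?_⟩
    rw [← ENNReal.ofReal_lt_iff_lt_toReal ht0 (hφ x)]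
    exact (ENNReal.lt_div_iff_mul_lt (Or.inl hM0) (Or.inl hM1)).2 hx
  have key := lintegral_add_le_lintegral_of_superlevel ha hb
    (f := fun x => (f x / A).toReal) (g := fun x => (g x / B).toReal)
    (h := fun x => (min (h x / C) 1).toReal)
    (hf.div_const _).ennreal_toReal (hg.div_const _).ennreal_toReal
    ((hh.div_const _).min measurable_const).ennreal_toReal
    (fun _ => ENNReal.toReal_nonneg) (fun _ => ENNReal.toReal_nonneg)
    (fun _ => ENNReal.toReal_nonneg)
    (fun x => ENNReal.toReal_le_of_le_ofReal zero_le_one (by simpa using fA' x))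
    (fun x => ENNReal.toReal_le_of_le_ofReal zero_le_one (by simpa using gB' x))
    (attained f A hA hA0 hf1 fA'') (attained g B hB hB0 hg1 gB'') ?_
  rotate_left
  · intro x y t ht hx hy
    rw [← ENNReal.ofReal_lt_iff_lt_toReal ht (fA'' x)] at hx
    rw [← ENNReal.ofReal_lt_iff_lt_toReal ht (gB'' y)] at hy
    rw [← ENNReal.ofReal_lt_iff_lt_toReal ht (hmin _)]
    refine lt_min ?_ (hx.trans_le (fA' x))
    have ht' : ENNReal.ofReal t = ENNReal.ofReal t ^ a * ENNReal.ofReal t ^ b := by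
      rw [← ENNReal.rpow_add_of_nonneg _ _ ha.le hb.le, hab, ENNReal.rpow_one]
    rw [ht']
    calc ENNReal.ofReal t ^ a * ENNReal.ofReal t ^ b
        < (f x / A) ^ a * (g y / B) ^ b :=
          ENNReal.mul_lt_mul (ENNReal.rpow_lt_rpow hx ha) (ENNReal.rpow_lt_rpow hy hb)
      _ = f x ^ a * g y ^ b / C := by
          rw [ENNReal.div_rpow_of_nonneg _ _ ha.le, ENNReal.div_rpow_of_nonneg _ _ hb.le, hC]
          rw [div_eq_mul_inv, div_eq_mul_inv, div_eq_mul_inv, ENNReal.mul_inv]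
          · ring
          · simp [hA0, hf1]
          · simp [hA0, hf1]
      _ ≤ h (a * x + b * y) / C := by gcongr; exact H x y
  simp only [ENNReal.ofReal_toReal (fA'' _), ENNReal.ofReal_toReal (gB'' _),
    ENNReal.ofReal_toReal (hmin _)] at key
  have key2 := (ENNReal.geom_mean_le_arith_mean ha hb hab _ _).trans (key.trans
    (lintegral_mono fun x => min_le_left _ _))
  simp only [div_eq_mul_inv] at key2
  rw [lintegral_mul_const _ hf, lintegral_mul_const _ hg, lintegral_mul_const _ hh,
    ENNReal.mul_rpow_of_nonneg _ _ ha.le, ENNReal.mul_rpow_of_nonneg _ _ hb.le,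
    ENNReal.inv_rpow, ENNReal.inv_rpow, mul_mul_mul_comm, ← ENNReal.mul_inv
      (by simp [hA0, hf1]) (by simp [hA0, hf1])] at key2
  exact (ENNReal.mul_le_mul_iff_left (ENNReal.inv_ne_zero.2 hC1) (ENNReal.inv_ne_top.2 hC0)).1 key2

theorem prekopaLeindler_real : PrekopaLeindler ℝ := by
  intro a b ha hb hab f g h hf hg hh H
  have trunc : ∀ φ : ℝ → ℝ≥0∞, Measurable φ →
      Tendsto (fun N : ℕ => ∫⁻ x, min (φ x) N) atTop (𝓝 (∫⁻ x, φ x)) := by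
    intro φ hφ
    refine lintegral_tendsto_of_tendsto_of_monotone (fun N => by fun_prop)
      (ae_of_all _ fun x N M hNM => min_le_min le_rfl (by exact_mod_cast hNM))
      (ae_of_all _ fun x => ?_)
    have := (tendsto_const_nhds (x := φ x)).min ENNReal.tendsto_nat_nhds_top
    simpa using this
  rcases eq_or_ne (∫⁻ x, f x) 0 with h0 | h0
  · simp [h0, ha]
  rcases eq_or_ne (∫⁻ x, g x) 0 with h1 | h1
  · simp [h1, hb]
  refine le_of_tendsto (ENNReal.Tendsto.mul ((trunc f hf).ennrpow_const a) (Or.inl ?_)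
    ((trunc g hg).ennrpow_const b) (Or.inl ?_)) (Eventually.of_forall fun N => ?_)
  · simp [h0, ha.le, ha]
  · simp [h1, hb.le, hb]
  refine prekopaLeindler_real_of_bounded ha hb hab (hf.min measurable_const)
    (hg.min measurable_const) hh ?_ ?_ fun x y => ?_
  · exact ((iSup_le fun x => min_le_right _ _).trans_lt (ENNReal.natCast_lt_top N)).ne
  · exact ((iSup_le fun x => min_le_right _ _).trans_lt (ENNReal.natCast_lt_top N)).ne
  · refine le_trans ?_ (H x y)
    gcongr <;> exact min_le_left _ _

theorem PrekopaLeindler.prod {E F : Type*} [AddCommGroup E] [Module ℝ E] [MeasureSpace E]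
    [AddCommGroup F] [Module ℝ F] [MeasureSpace F] [SFinite (volume : Measure F)]
    (hE : PrekopaLeindler E) (hF : PrekopaLeindler F) : PrekopaLeindler (E × F) := by
  intro a b ha hb hab f g h hf hg hh H
  simp only [Measure.volume_eq_prod]
  rw [lintegral_prod _ hf.aemeasurable, lintegral_prod _ hg.aemeasurable,
    lintegral_prod _ hh.aemeasurable]
  refine hE a b ha hb hab _ _ _ hf.lintegral_prod_right' hg.lintegral_prod_right'
    hh.lintegral_prod_right' fun x y => ?_
  exact hF a b ha hb hab _ _ _ (hf.comp measurable_prodMk_left) (hg.comp measurable_prodMk_left)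
    (hh.comp measurable_prodMk_left) fun u v => H (x, u) (y, v)

theorem PrekopaLeindler.of_measurePreserving {E F : Type*} [AddCommGroup E] [Module ℝ E]
    [MeasureSpace E] [AddCommGroup F] [Module ℝ F] [MeasureSpace F] (hE : PrekopaLeindler E)
    (e : E →ₗ[ℝ] F) (he : MeasurePreserving e) : PrekopaLeindler F := by
  intro a b ha hb hab f g h hf hg hh H
  rw [← he.lintegral_comp hf, ← he.lintegral_comp hg, ← he.lintegral_comp hh]
  refine hE a b ha hb hab _ _ _ (hf.comp he.measurable) (hg.comp he.measurable)
    (hh.comp he.measurable) fun x y => ?_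
  simpa using H (e x) (e y)

theorem prekopaLeindler_pi (n : ℕ) : PrekopaLeindler (Fin n → ℝ) := by
  induction n with
  | zero =>
    intro a b ha hb hab f g h hf hg hh H
    have eval : ∀ φ : (Fin 0 → ℝ) → ℝ≥0∞, ∫⁻ x, φ x = φ default := fun φ => by
      simp only [volume_pi, lintegral_unique]
      simpa using congrArg φ (Subsingleton.elim _ _)
    rw [eval, eval, eval]
    convert H default default
  | succ n ih =>
    refine (prekopaLeindler_real.prod ih).of_measurePreserving
      (Fin.consLinearEquiv ℝ (fun _ : Fin (n + 1) => ℝ)).toLinearMap ?_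
    have key : ⇑(Fin.consLinearEquiv ℝ fun _ : Fin (n + 1) => ℝ).toLinearMap =
        ⇑(MeasurableEquiv.piFinSuccAbove (fun _ : Fin (n + 1) => ℝ) 0).symm := by
      funext x
      simp [MeasurableEquiv.piFinSuccAbove, Fin.insertNthEquiv, Fin.consLinearEquiv]
      rfl
    rw [key]
    exact (volume_preserving_piFinSuccAbove (fun _ : Fin (n + 1) => ℝ) 0).symm

theorem prekopaLeindler_euclideanSpace (n : ℕ) : PrekopaLeindler (EuclideanSpace ℝ (Fin n)) :=
  (prekopaLeindler_pi n).of_measurePreserving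
    (WithLp.linearEquiv 2 ℝ (Fin n → ℝ)).symm.toLinearMap
    (EuclideanSpace.volume_preserving_symm_measurableEquiv_toLp (Fin n)).symm

/-- Brunn–Minkowski inequality for a set and a ball. -/
theorem volume_ball_add_le {n : ℕ} {A C : Set (EuclideanSpace ℝ (Fin n))}
    (hA : MeasurableSet A) (hC : MeasurableSet C) {ρ ε : ℝ} (hρ : 0 < ρ) (hε : 0 < ε)
    (hAρ : volume A = volume (ball (0 : EuclideanSpace ℝ (Fin n)) ρ))
    (hAC : A + ball 0 ε ⊆ C) :
    volume (ball (0 : EuclideanSpace ℝ (Fin n)) (ρ + ε)) ≤ volume C := by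
  have hs : 0 < ρ + ε := by positivity
  have ha : 0 < ρ / (ρ + ε) := by positivity
  have hb : 0 < ε / (ρ + ε) := by positivity
  have hab : ρ / (ρ + ε) + ε / (ρ + ε) = 1 := by field_simp
  have pre : ∀ δ : ℝ, 0 < δ / (ρ + ε) →
      (fun x : EuclideanSpace ℝ (Fin n) => (δ / (ρ + ε)) • x) ⁻¹' ball 0 δ
        = ball 0 (ρ + ε) := by
    intro δ hδ
    ext x
    have hδ' : 0 < δ := by
      rcases div_pos_iff.1 hδ with h | h <;> linarith
    simp only [Set.mem_preimage, mem_ball_zero_iff, norm_smul, Real.norm_eq_abs, abs_of_pos hδ]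
    rw [div_mul_eq_mul_div, div_lt_iff₀ hs, mul_lt_mul_iff_right₀ hδ']
  have hmA : MeasurableSet
      ((fun x : EuclideanSpace ℝ (Fin n) => (ρ / (ρ + ε)) • x) ⁻¹' A) :=
    hA.preimage (by fun_prop)
  have hvA : volume ((fun x : EuclideanSpace ℝ (Fin n) => (ρ / (ρ + ε)) • x) ⁻¹' A) =
      volume (ball (0 : EuclideanSpace ℝ (Fin n)) (ρ + ε)) := by
    rw [← pre ρ ha, Measure.addHaar_preimage_smul _ ha.ne', Measure.addHaar_preimage_smul _ ha.ne',
      hAρ]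
  have key := prekopaLeindler_euclideanSpace n _ _ ha hb hab
    (Set.indicator ((fun x => (ρ / (ρ + ε)) • x) ⁻¹' A) 1)
    (Set.indicator (ball 0 (ρ + ε)) 1) (Set.indicator C 1)
    (measurable_one.indicator hmA) (measurable_one.indicator measurableSet_ball)
    (measurable_one.indicator hC) fun x y => ?_
  · rw [lintegral_indicator_one hmA, lintegral_indicator_one measurableSet_ball,
      lintegral_indicator_one hC, hvA, ← ENNReal.rpow_add_of_nonneg _ _ ha.le hb.le, hab,
      ENNReal.rpow_one] at key
    exact key
  · by_cases hx : x ∈ (fun x => (ρ / (ρ + ε)) • x) ⁻¹' A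
    · by_cases hy : y ∈ ball (0 : EuclideanSpace ℝ (Fin n)) (ρ + ε)
      · have : (ρ / (ρ + ε)) • x + (ε / (ρ + ε)) • y ∈ C := by
          refine hAC (Set.add_mem_add hx ?_)
          rw [← pre ε hb] at hy
          exact hy
        rw [Set.indicator_of_mem hx, Set.indicator_of_mem hy, Set.indicator_of_mem this]
        simp
      · rw [Set.indicator_of_notMem hy]
        simp [hb]
    · rw [Set.indicator_of_notMem hx]
      simp [ha]

/-- The supremum of a function over the closed ball of radius `ε` around a point. -/
noncomputable def ballSup {E : Type*} [SeminormedAddCommGroup E] (u : E → ℝ) (ε : ℝ) (x : E) : ℝ :=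
  ⨆ y : closedBall (0 : E) ε, u (x + y)

section ballSup

variable {E : Type*} [NormedAddCommGroup E] {u : E → ℝ} {K : ℝ≥0} {ε : ℝ}

theorem LipschitzWith.le_add_mul_norm (hu : LipschitzWith K u) (x y : E) :
    u (x + y) ≤ u x + K * ‖y‖ := by
  have := hu.dist_le_mul (x + y) x
  rw [dist_eq_norm, Real.norm_eq_abs, dist_eq_norm, add_sub_cancel_left] at this
  linarith [le_abs_self (u (x + y) - u x)]

theorem LipschitzWith.bddAbove_range_closedBall (hu : LipschitzWith K u) (ε : ℝ) (x : E) :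
    BddAbove (Set.range fun y : closedBall (0 : E) ε => u (x + y)) := by
  refine ⟨u x + K * ε, ?_⟩
  rintro _ ⟨⟨y, hy⟩, rfl⟩
  rw [mem_closedBall_zero_iff] at hy
  exact (hu.le_add_mul_norm x y).trans (by gcongr)

theorem le_ballSup (hu : LipschitzWith K u) {x y : E} (hy : ‖y‖ ≤ ε) :
    u (x + y) ≤ ballSup u ε x :=
  le_ciSup (hu.bddAbove_range_closedBall ε x) ⟨y, by simpa using hy⟩

theorem ballSup_le (hε : 0 ≤ ε) {x : E} {c : ℝ} (h : ∀ y, ‖y‖ ≤ ε → u (x + y) ≤ c) :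
    ballSup u ε x ≤ c :=
  have : Nonempty (closedBall (0 : E) ε) := ⟨⟨0, by simpa using hε⟩⟩
  ciSup_le fun y => h y (mem_closedBall_zero_iff.1 y.2)

theorem le_ballSup_self (hu : LipschitzWith K u) (hε : 0 ≤ ε) (x : E) : u x ≤ ballSup u ε x := by
  simpa using le_ballSup hu (x := x) (y := 0) (by simpa using hε)

theorem ballSup_le_add (hu : LipschitzWith K u) (hε : 0 ≤ ε) (x : E) :
    ballSup u ε x ≤ u x + K * ε :=
  ballSup_le hε fun y hy => (hu.le_add_mul_norm x y).trans (by gcongr)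

theorem lt_ballSup_iff (hu : LipschitzWith K u) (hε : 0 ≤ ε) {x : E} {t : ℝ} :
    t < ballSup u ε x ↔ ∃ y, ‖y‖ ≤ ε ∧ t < u (x + y) := by
  refine ⟨fun h => ?_, fun ⟨y, hy, h⟩ => h.trans_le (le_ballSup hu hy)⟩
  by_contra! H
  exact absurd (ballSup_le hε H) (not_le.2 h)

theorem measurable_ballSup [MeasurableSpace E] [BorelSpace E] (hu : LipschitzWith K u)
    (hε : 0 ≤ ε) : Measurable (ballSup u ε) := by
  refine measurable_of_Ioi fun t => IsOpen.measurableSet ?_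
  have : ballSup u ε ⁻¹' Set.Ioi t = ⋃ y ∈ closedBall (0 : E) ε, {x | t < u (x + y)} := by
    ext x
    simp [lt_ballSup_iff hu hε]
  rw [this]
  exact isOpen_biUnion fun y _ => isOpen_lt continuous_const
    (hu.continuous.comp (continuous_add_const y))

theorem tendsto_ballSup_sub_div [NormedSpace ℝ E] (hu : LipschitzWith K u) {x : E}
    (hx : DifferentiableAt ℝ u x) :
    Tendsto (fun ε : ℝ => (ballSup u ε x - u x) / ε) (𝓝[>] 0) (𝓝 ‖fderiv ℝ u x‖) := by
  rw [Metric.tendsto_nhds]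
  intro c hc
  set L := fderiv ℝ u x with hL
  have h := (hasFDerivAt_iff_isLittleO_nhds_zero.1 hx.hasFDerivAt).def (c := c / 4) (by positivity)
  obtain ⟨δ, hδ, hδ'⟩ := Metric.eventually_nhds_iff.1 h
  have expand : ∀ y, ‖y‖ < δ → |u (x + y) - u x - L y| ≤ c / 4 * ‖y‖ := fun y hy => by
    simpa using hδ' (by simpa using hy)
  filter_upwards [Ioo_mem_nhdsGT hδ] with ε ⟨hε, hεδ⟩
  rw [Real.dist_eq]
  have upper : ballSup u ε x - u x ≤ (‖L‖ + c / 4) * ε := by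
    rw [sub_le_iff_le_add]
    refine ballSup_le hε.le fun y hy => ?_
    have h1 := (abs_le.1 (expand y (hy.trans_lt hεδ))).2
    have h2 := (le_abs_self _).trans (L.le_opNorm y)
    have h3 : (‖L‖ + c / 4) * ‖y‖ ≤ (‖L‖ + c / 4) * ε := by gcongr
    linarith
  have lower : (‖L‖ - c / 2) * ε ≤ ballSup u ε x - u x := by
    obtain ⟨v, hv, hLv⟩ : ∃ v : E, ‖v‖ ≤ 1 ∧ ‖L‖ - c / 4 ≤ L v := by
      rcases lt_or_ge (‖L‖ - c / 4) 0 with h0 | h0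
      · exact ⟨0, by simp, by simpa using h0.le⟩
      obtain ⟨v, hv, hLv⟩ := L.exists_lt_apply_of_lt_opNorm (r := ‖L‖ - c / 4) (by linarith)
      rcases abs_cases (L v) with h | h
      · exact ⟨v, hv.le, by rw [Real.norm_eq_abs] at hLv; linarith⟩
      · exact ⟨-v, by simpa using hv.le, by rw [Real.norm_eq_abs] at hLv; simp; linarith⟩
    have hεv : ‖ε • v‖ ≤ ε := by
      rw [norm_smul, Real.norm_eq_abs, abs_of_pos hε]
      nlinarith
    have h1 := (abs_le.1 (expand (ε • v) (hεv.trans_lt hεδ))).1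
    have h2 := le_ballSup hu (x := x) hεv
    have h3 : c / 4 * ‖ε • v‖ ≤ c / 4 * ε := by gcongr
    have h4 : (‖L‖ - c / 4) * ε ≤ L (ε • v) := by
      rw [map_smul, smul_eq_mul, mul_comm]
      gcongr
    linarith
  rw [abs_lt, lt_sub_iff_add_lt, sub_lt_iff_lt_add, lt_div_iff₀ hε, div_lt_iff₀ hε]
  constructor
  · nlinarith
  · nlinarith

theorem norm_ballSup_sub_div_le {R : ℝ} (hu : LipschitzWith K u)
    (hR : tsupport u ⊆ closedBall 0 R) (hε : 0 < ε) (hε1 : ε ≤ 1) (x : E) :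
    ‖(ballSup u ε x - u x) / ε‖ ≤ (closedBall (0 : E) (R + 1)).indicator (fun _ => (K : ℝ)) x := by
  have h1 := le_ballSup_self hu hε.le x
  rw [Real.norm_of_nonneg (div_nonneg (sub_nonneg.2 h1) hε.le), div_le_iff₀ hε]
  by_cases hx : x ∈ closedBall (0 : E) (R + 1)
  · rw [Set.indicator_of_mem hx]
    linarith [ballSup_le_add hu hε.le x]
  · rw [Set.indicator_of_notMem hx, zero_mul]
    rw [mem_closedBall_zero_iff, not_le] at hx
    have hz : ∀ y, ‖y‖ ≤ ε → u (x + y) = 0 := fun y hy => by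
      refine image_eq_zero_of_notMem_tsupport fun h => ?_
      have := mem_closedBall_zero_iff.1 (hR h)
      have := norm_sub_le (x + y) y
      rw [add_sub_cancel_right] at this
      linarith
    have h2 := ballSup_le hε.le (x := x) fun y hy => (hz y hy).le
    have h3 := hz 0 (by simpa using hε.le)
    rw [add_zero] at h3
    linarith

variable [NormedSpace ℝ E] [FiniteDimensional ℝ E] [MeasurableSpace E] [BorelSpace E]
  {μ : Measure E} [μ.IsAddHaarMeasure]

theorem integrable_ballSup_sub_div (hu : LipschitzWith K u) (hu' : HasCompactSupport u)
    (hε : 0 < ε) (hε1 : ε ≤ 1) : Integrable (fun x => (ballSup u ε x - u x) / ε) μ := by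
  obtain ⟨R, hR⟩ := hu'.isBounded.subset_closedBall (0 : E)
  refine Integrable.mono' (g := (closedBall (0 : E) (R + 1)).indicator (fun _ => (K : ℝ))) ?_ ?_
    (ae_of_all _ (norm_ballSup_sub_div_le hu hR hε hε1))
  · exact (integrable_indicator_iff measurableSet_closedBall).2
      (integrableOn_const measure_closedBall_lt_top.ne)
  · exact (((measurable_ballSup hu hε.le).sub hu.continuous.measurable).div_const _
      |>.aestronglyMeasurable)

theorem integrable_ballSup (hu : LipschitzWith K u) (hu' : HasCompactSupport u)
    (hε : 0 < ε) (hε1 : ε ≤ 1) : Integrable (ballSup u ε) μ := by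
  have := ((integrable_ballSup_sub_div (μ := μ) hu hu' hε hε1).mul_const ε).add
    (hu.continuous.integrable_of_hasCompactSupport hu')
  refine this.congr (ae_of_all _ fun x => ?_)
  simp [hε.ne']

theorem tendsto_integral_ballSup_sub_div (hu : LipschitzWith K u) (hu' : HasCompactSupport u) :
    Tendsto (fun ε : ℝ => ∫ x, (ballSup u ε x - u x) / ε ∂μ) (𝓝[>] 0)
      (𝓝 (∫ x, ‖fderiv ℝ u x‖ ∂μ)) := by
  obtain ⟨R, hR⟩ := hu'.isBounded.subset_closedBall (0 : E)
  refine tendsto_integral_filter_of_dominated_convergence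
    ((closedBall (0 : E) (R + 1)).indicator (fun _ => (K : ℝ))) ?_ ?_ ?_ ?_
  · filter_upwards [Ioc_mem_nhdsGT one_pos] with ε hε
    exact (integrable_ballSup_sub_div hu hu' hε.1 hε.2).aestronglyMeasurable
  · filter_upwards [Ioc_mem_nhdsGT one_pos] with ε hε
    exact ae_of_all _ (norm_ballSup_sub_div_le hu hR hε.1 hε.2)
  · exact (integrable_indicator_iff measurableSet_closedBall).2
      (integrableOn_const measure_closedBall_lt_top.ne)
  · filter_upwards [hu.ae_differentiableAt] with x hx
    exact tendsto_ballSup_sub_div hu hx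

end ballSup

/-- For `t ≥ 0`, the superlevel sets of `u` and `v` at height `t` have the same measure, and those
of `v` are balls centered at the origin. -/
structure IsBallRearrangement {n : ℕ} (u v : EuclideanSpace ℝ (Fin n) → ℝ) : Prop where
  volume_eq : ∀ t, 0 ≤ t → volume {x | t < u x} = volume {x | t < v x}
  exists_ball : ∀ t, 0 ≤ t → ∃ ρ, {x | t < v x} = ball 0 ρ

namespace IsBallRearrangement

variable {n : ℕ} {u v : EuclideanSpace ℝ (Fin n) → ℝ} {K K' : ℝ≥0}

theorem volume_ballSup_le (h : IsBallRearrangement u v) (hu : LipschitzWith K u)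
    (hv : LipschitzWith K' v) {ε t : ℝ} (hε : 0 < ε) (ht : 0 ≤ t) :
    volume {x | t < ballSup v ε x} ≤ volume {x | t < ballSup u ε x} := by
  obtain ⟨ρ, hρ⟩ := h.exists_ball t ht
  rcases le_or_gt ρ 0 with hρ0 | hρ0
  · rw [ball_eq_empty.2 hρ0] at hρ
    have : {x | t < ballSup v ε x} = ∅ := by
      refine Set.eq_empty_of_forall_notMem fun x hx => ?_
      obtain ⟨y, -, hy⟩ := (lt_ballSup_iff hv hε.le).1 hx
      exact (hρ ▸ hy : x + y ∈ (∅ : Set _))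
    simp [this]
  · calc volume {x | t < ballSup v ε x} ≤
          volume (ball (0 : EuclideanSpace ℝ (Fin n)) (ρ + ε)) := by
          refine measure_mono fun x hx => ?_
          obtain ⟨y, hy, hxy⟩ := (lt_ballSup_iff hv hε.le).1 hx
          have h1 : x + y ∈ ball 0 ρ := hρ ▸ hxy
          rw [mem_ball_zero_iff] at h1 ⊢
          have := norm_sub_le (x + y) y
          rw [add_sub_cancel_right] at this
          linarith
      _ ≤ volume {x | t < ballSup u ε x} := by
          refine volume_ball_add_le (measurableSet_lt measurable_const hu.continuous.measurable)
            (measurableSet_lt measurable_const (measurable_ballSup hu hε.le)) hρ0 hε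
            (by rw [← hρ]; exact h.volume_eq t ht) ?_
          rintro _ ⟨x, hx, y, hy, rfl⟩
          refine (lt_ballSup_iff hu hε.le).2 ⟨-y, ?_, by simpa using hx⟩
          simpa using (mem_ball_zero_iff.1 hy).le

theorem integral_norm_fderiv_le (h : IsBallRearrangement u v) (hu : LipschitzWith K u)
    (hv : LipschitzWith K' v) (hu' : HasCompactSupport u) (hv' : HasCompactSupport v)
    (hu0 : ∀ x, 0 ≤ u x) (hv0 : ∀ x, 0 ≤ v x) :
    ∫ x, ‖fderiv ℝ v x‖ ≤ ∫ x, ‖fderiv ℝ u x‖ := by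
  refine le_of_tendsto_of_tendsto (tendsto_integral_ballSup_sub_div hv hv')
    (tendsto_integral_ballSup_sub_div hu hu') ?_
  filter_upwards [Ioc_mem_nhdsGT one_pos] with ε ⟨hε, hε1⟩
  have iu := hu.continuous.integrable_of_hasCompactSupport (μ := volume) hu'
  have iv := hv.continuous.integrable_of_hasCompactSupport (μ := volume) hv'
  have isu := integrable_ballSup (μ := volume) hu hu' hε hε1
  have isv := integrable_ballSup (μ := volume) hv hv' hε hε1
  have su0 : ∀ x, 0 ≤ ballSup u ε x := fun x => (hu0 x).trans (le_ballSup_self hu hε.le x)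
  have sv0 : ∀ x, 0 ≤ ballSup v ε x := fun x => (hv0 x).trans (le_ballSup_self hv hε.le x)
  rw [integral_div, integral_div, integral_sub isu iu, integral_sub isv iv]
  have e1 : ∫ x, u x = ∫ x, v x := by
    rw [integral_eq_lintegral_of_nonneg_ae (ae_of_all _ hu0) iu.1,
      integral_eq_lintegral_of_nonneg_ae (ae_of_all _ hv0) iv.1,
      lintegral_eq_lintegral_meas_lt _ (ae_of_all _ hu0) iu.1.aemeasurable,
      lintegral_eq_lintegral_meas_lt _ (ae_of_all _ hv0) iv.1.aemeasurable]
    congr 1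
    exact setLIntegral_congr_fun measurableSet_Ioi fun t ht => h.volume_eq t (le_of_lt ht)
  have e2 : ∫ x, ballSup v ε x ≤ ∫ x, ballSup u ε x := by
    rw [integral_eq_lintegral_of_nonneg_ae (ae_of_all _ su0) isu.1,
      integral_eq_lintegral_of_nonneg_ae (ae_of_all _ sv0) isv.1]
    refine ENNReal.toReal_mono ?_ ?_
    · rw [← ofReal_integral_eq_lintegral_ofReal isu (ae_of_all _ su0)]
      exact ENNReal.ofReal_ne_top
    rw [lintegral_eq_lintegral_meas_lt _ (ae_of_all _ su0) isu.1.aemeasurable,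
      lintegral_eq_lintegral_meas_lt _ (ae_of_all _ sv0) isv.1.aemeasurable]
    exact setLIntegral_mono' measurableSet_Ioi fun t ht =>
      h.volume_ballSup_le hu hv hε (le_of_lt ht)
  rw [e1]
  gcongr

end IsBallRearrangement

theorem MeasureTheory.Measure.le_of_Ioo_le {μ ν : Measure ℝ} [IsFiniteMeasure μ]
    [IsFiniteMeasure ν] (h : ∀ a b, μ (Set.Ioo a b) ≤ ν (Set.Ioo a b)) : μ ≤ ν := by
  have hIoc : ∀ a b, μ (Set.Ioc a b) ≤ ν (Set.Ioc a b) := by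
    intro a b
    have key : ∀ (ρ : Measure ℝ) [IsFiniteMeasure ρ],
        Tendsto (fun r => ρ (Set.Ioo a r)) (𝓝[>] b) (𝓝 (ρ (Set.Ioc a b))) := by
      intro ρ _
      have := tendsto_measure_biInter_gt (μ := ρ) (s := fun r => Set.Ioo a r) (a := b)
        (fun r _ => measurableSet_Ioo.nullMeasurableSet)
        (fun i j _ hij => Set.Ioo_subset_Ioo_right hij) ⟨b + 1, by simp, measure_ne_top _ _⟩
      have e : ⋂ r > b, Set.Ioo a r = Set.Ioc a b := by
        ext x
        simp only [Set.mem_Ioc, Set.mem_iInter, Set.mem_Ioo]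
        exact ⟨fun hx => ⟨(hx (b + 1) (by simp)).1,
          le_of_forall_gt_imp_ge_of_dense fun r hr => (hx r hr).2.le⟩,
          fun hx r hr => ⟨hx.1, hx.2.trans_lt hr⟩⟩
      rwa [e] at this
    exact le_of_tendsto_of_tendsto' (key μ) (key ν) fun r => h a r
  have right_cont : ∀ (ρ : Measure ℝ) [IsFiniteMeasure ρ] (x : ℝ),
      ContinuousWithinAt (fun x => ρ.real (Set.Iic x)) (Set.Ici x) x := by
    intro ρ _ x
    rw [← continuousWithinAt_Ioi_iff_Ici]
    have := tendsto_measure_biInter_gt (μ := ρ) (s := fun r => Set.Iic r) (a := x)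
      (fun r _ => measurableSet_Iic.nullMeasurableSet)
      (fun i j _ hij => Set.Iic_subset_Iic.2 hij) ⟨x + 1, by simp, measure_ne_top _ _⟩
    have e : ⋂ r > x, Set.Iic r = Set.Iic x := by
      ext y
      simp only [Set.mem_iInter, Set.mem_Iic]
      exact ⟨fun hy => le_of_forall_gt_imp_ge_of_dense hy, fun hy r hr => hy.trans hr.le⟩
    rw [e] at this
    exact (ENNReal.tendsto_toReal (measure_ne_top _ _)).comp this
  have hreal : ∀ (ρ : Measure ℝ) [IsFiniteMeasure ρ] (a b : ℝ), a ≤ b →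
      ρ.real (Set.Iic b) = ρ.real (Set.Iic a) + ρ.real (Set.Ioc a b) := by
    intro ρ _ a b hab
    rw [← measureReal_union _ measurableSet_Ioc, Set.Iic_union_Ioc_eq_Iic hab]
    exact Set.disjoint_left.2 fun x hx hx' => absurd hx'.1 (not_lt.2 hx)
  have hIoc' : ∀ a b, μ.real (Set.Ioc a b) ≤ ν.real (Set.Ioc a b) := fun a b =>
    ENNReal.toReal_mono (measure_ne_top _ _) (hIoc a b)
  let F : StieltjesFunction ℝ :=
    { toFun := fun x => ν.real (Set.Iic x) - μ.real (Set.Iic x)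
      mono' := fun a b hab => by
        simp only
        rw [hreal μ a b hab, hreal ν a b hab]
        linarith [hIoc' a b]
      right_continuous' := fun x => (right_cont ν x).sub (right_cont μ x) }
  have : ν = μ + F.measure := by
    refine Measure.ext_of_Ioc _ _ fun a b hab => ?_
    have e : F b - F a = ν.real (Set.Ioc a b) - μ.real (Set.Ioc a b) := by
      change (ν.real (Set.Iic b) - μ.real (Set.Iic b)) -
        (ν.real (Set.Iic a) - μ.real (Set.Iic a)) = _
      rw [hreal μ a b hab.le, hreal ν a b hab.le]
      ring
    rw [Measure.add_apply, StieltjesFunction.measure_Ioc, e, ← ofReal_measureReal (μ := μ),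
      ← ENNReal.ofReal_add measureReal_nonneg (sub_nonneg.2 (hIoc' a b)),
      add_sub_cancel, ofReal_measureReal]
  rw [this]
  exact Measure.le_add_right le_rfl

section Truncation

/-- The part of `u` between the heights `s` and `t`. -/
def levelTrunc {E : Type*} (s t : ℝ) (u : E → ℝ) (x : E) : ℝ :=
  min (max (u x - s) 0) (t - s)

theorem levelTrunc_nonneg {E : Type*} {u : E → ℝ} {s t : ℝ} (hst : s ≤ t) (x : E) :
    0 ≤ levelTrunc s t u x :=
  le_min (le_max_right _ _) (sub_nonneg.2 hst)

theorem setOf_lt_levelTrunc {E : Type*} {u : E → ℝ} {s t τ : ℝ} (hτ : 0 ≤ τ) :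
    {x | τ < levelTrunc s t u x} = if τ < t - s then {x | s + τ < u x} else ∅ := by
  ext x
  have : τ < levelTrunc s t u x ↔ s + τ < u x ∧ τ < t - s := by
    rw [levelTrunc, lt_min_iff, lt_max_iff, lt_sub_iff_add_lt']
    simp [not_lt.2 hτ]
  split_ifs with h <;> simp [this, h]

variable {E : Type*} [NormedAddCommGroup E] {u : E → ℝ} {K : ℝ≥0} {s t : ℝ}

theorem LipschitzWith.levelTrunc (hu : LipschitzWith K u) (s t : ℝ) :
    LipschitzWith K (levelTrunc s t u) := by
  have := ((hu.sub (LipschitzWith.const s)).max_const 0).min_const (t - s)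
  rwa [add_zero] at this

theorem HasCompactSupport.levelTrunc (hu : HasCompactSupport u) (hs : 0 ≤ s) (hst : s ≤ t) :
    HasCompactSupport (levelTrunc s t u) :=
  hu.comp_left (g := fun r => min (max (r - s) 0) (t - s)) (by simp [hs, hst])

theorem enorm_fderiv_levelTrunc [NormedSpace ℝ E] (hu : Continuous u) (hst : s < t) (x : E) :
    ‖fderiv ℝ (levelTrunc s t u) x‖ₑ =
      (u ⁻¹' Set.Ioo s t).indicator (fun x => ‖fderiv ℝ u x‖ₑ) x := by
  by_cases hx : x ∈ u ⁻¹' Set.Ioo s t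
  · rw [Set.indicator_of_mem hx]
    have : levelTrunc s t u =ᶠ[𝓝 x] fun y => u y - s := by
      filter_upwards [(isOpen_Ioo.preimage hu).mem_nhds hx] with y hy
      rw [levelTrunc, max_eq_left (sub_nonneg.2 hy.1.le), min_eq_left]
      exact sub_le_sub_right hy.2.le s
    rw [this.fderiv_eq, fderiv_sub_const]
  · rw [Set.indicator_of_notMem hx]
    have : fderiv ℝ (levelTrunc s t u) x = 0 := by
      rcases le_or_gt (u x) s with h | h
      · refine IsLocalMin.fderiv_eq_zero (Eventually.of_forall fun y => ?_)
        have : levelTrunc s t u x = 0 := by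
          rw [levelTrunc, max_eq_right (sub_nonpos.2 h), min_eq_left (sub_nonneg.2 hst.le)]
        rw [this]
        exact levelTrunc_nonneg hst.le y
      · have h' : t ≤ u x := not_lt.1 fun h' => hx ⟨h, h'⟩
        refine IsLocalMax.fderiv_eq_zero (Eventually.of_forall fun y => ?_)
        have : levelTrunc s t u x = t - s := by
          rw [levelTrunc, min_eq_right]
          exact (sub_le_sub_right h' s).trans (le_max_left _ _)
        rw [this]
        exact min_le_right _ _
    rw [this, ← ofReal_norm, norm_zero, ENNReal.ofReal_zero]

end Truncation

section GradientMeasure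

theorem LipschitzWith.enorm_fderiv_le {E : Type*} [NormedAddCommGroup E] [NormedSpace ℝ E]
    {u : E → ℝ} {K : ℝ≥0} (hu : LipschitzWith K u) (x : E) :
    ‖fderiv ℝ u x‖ₑ ≤ K := by
  rw [← ofReal_norm, ← ENNReal.ofReal_coe_nnreal]
  exact ENNReal.ofReal_le_ofReal (norm_fderiv_le_of_lipschitz ℝ hu)

variable {E : Type*} [NormedAddCommGroup E] [NormedSpace ℝ E] [MeasureSpace E]

/-- The push-forward under `u` of the measure with density `‖∇u‖`. -/
noncomputable def gradientMeasure (u : E → ℝ) : Measure ℝ :=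
  (volume.withDensity fun x => ‖fderiv ℝ u x‖ₑ).map u

theorem gradientMeasure_apply {u : E → ℝ} (hu : Measurable u) {s : Set ℝ} (hs : MeasurableSet s) :
    gradientMeasure u s = ∫⁻ x in u ⁻¹' s, ‖fderiv ℝ u x‖ₑ := by
  rw [gradientMeasure, Measure.map_apply hu hs, withDensity_apply _ (hu hs)]

theorem gradientMeasure_Ioo_max {u : E → ℝ} (hu : Measurable u) (hu0 : ∀ x, 0 ≤ u x) (s t : ℝ) :
    gradientMeasure u (Set.Ioo s t) = gradientMeasure u (Set.Ioo (max s 0) t) := by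
  rw [gradientMeasure_apply hu measurableSet_Ioo, gradientMeasure_apply hu measurableSet_Ioo,
    ← lintegral_indicator (hu measurableSet_Ioo), ← lintegral_indicator (hu measurableSet_Ioo)]
  refine lintegral_congr fun x => ?_
  rcases (hu0 x).eq_or_lt with h | h
  · have : fderiv ℝ u x = 0 :=
      IsLocalMin.fderiv_eq_zero (Eventually.of_forall fun y => h ▸ hu0 y)
    have h0 : ‖fderiv ℝ u x‖ₑ = 0 := by
      rw [this, ← ofReal_norm, norm_zero, ENNReal.ofReal_zero]
    have (A : Set E) : A.indicator (fun x => ‖fderiv ℝ u x‖ₑ) x = 0 :=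
      Set.indicator_apply_eq_zero.2 fun _ => h0
    rw [this, this]
  · by_cases hx : u x ∈ Set.Ioo s t
    · have hx' : u x ∈ Set.Ioo (max s 0) t := ⟨max_lt hx.1 h, hx.2⟩
      rw [Set.indicator_of_mem (s := u ⁻¹' _) hx, Set.indicator_of_mem (s := u ⁻¹' _) hx']
    · have hx' : u x ∉ Set.Ioo (max s 0) t := fun hx' =>
        hx ⟨(le_max_left _ _).trans_lt hx'.1, hx'.2⟩
      rw [Set.indicator_of_notMem (s := u ⁻¹' _) hx, Set.indicator_of_notMem (s := u ⁻¹' _) hx']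

variable [BorelSpace E]

theorem integral_norm_fderiv_rpow (u : E → ℝ) {p : ℝ} (hp : 0 ≤ p) :
    ∫ x, ‖fderiv ℝ u x‖ ^ p = (∫⁻ x, ‖fderiv ℝ u x‖ₑ ^ p).toReal := by
  rw [integral_eq_lintegral_of_nonneg_ae (ae_of_all _ fun x => by positivity)
    (((measurable_fderiv ℝ u).norm.pow_const p).aestronglyMeasurable)]
  congr 2 with x
  rw [← ENNReal.ofReal_rpow_of_nonneg (norm_nonneg _) hp, ofReal_norm]

theorem lintegral_gradientMeasure {u : E → ℝ} (hu : Measurable u) {φ : ℝ → ℝ≥0∞}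
    (hφ : Measurable φ) :
    ∫⁻ t, φ t ∂gradientMeasure u = ∫⁻ x, ‖fderiv ℝ u x‖ₑ * φ (u x) := by
  rw [gradientMeasure, lintegral_map hφ hu]
  exact lintegral_withDensity_eq_lintegral_mul _ (measurable_fderiv ℝ u).enorm (hφ.comp hu)

theorem gradientMeasure_Ioo {u : E → ℝ} (hu : Continuous u) {s t : ℝ} (hst : s < t) :
    gradientMeasure u (Set.Ioo s t) = ∫⁻ x, ‖fderiv ℝ (levelTrunc s t u) x‖ₑ := by
  rw [gradientMeasure_apply hu.measurable measurableSet_Ioo]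
  simp_rw [enorm_fderiv_levelTrunc hu hst]
  rw [lintegral_indicator (hu.measurable measurableSet_Ioo)]

theorem LipschitzWith.lintegral_enorm_fderiv_rpow_lt_top [(volume : Measure E).IsAddHaarMeasure]
    {u : E → ℝ} {K : ℝ≥0} (hu : LipschitzWith K u)
    (hu' : HasCompactSupport u) {p : ℝ} (hp : 0 < p) : ∫⁻ x, ‖fderiv ℝ u x‖ₑ ^ p < ∞ := by
  have hle : ∀ x, ‖fderiv ℝ u x‖ₑ ^ p ≤
      (tsupport u).indicator (fun _ => (K : ℝ≥0∞) ^ p) x := by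
    intro x
    by_cases hx : x ∈ tsupport u
    · rw [Set.indicator_of_mem hx]
      gcongr
      exact hu.enorm_fderiv_le x
    · have : fderiv ℝ u x = 0 := by
        by_contra h
        exact hx (support_fderiv_subset ℝ h)
      rw [this, ← ofReal_norm, norm_zero, ENNReal.ofReal_zero, ENNReal.zero_rpow_of_pos hp]
      exact zero_le
  refine (lintegral_mono hle).trans_lt ?_
  rw [lintegral_indicator (isClosed_tsupport u).measurableSet, setLIntegral_const]
  exact ENNReal.mul_lt_top (ENNReal.rpow_lt_top_of_nonneg hp.le ENNReal.coe_ne_top)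
    hu'.isCompact.measure_lt_top

theorem isFiniteMeasure_gradientMeasure [(volume : Measure E).IsAddHaarMeasure] {u : E → ℝ}
    {K : ℝ≥0} (hu : LipschitzWith K u) (hu' : HasCompactSupport u) :
    IsFiniteMeasure (gradientMeasure u) := by
  refine ⟨?_⟩
  rw [gradientMeasure_apply hu.continuous.measurable .univ]
  simpa using hu.lintegral_enorm_fderiv_rpow_lt_top hu' one_pos

end GradientMeasure

namespace IsBallRearrangement

variable {n : ℕ} {u v : EuclideanSpace ℝ (Fin n) → ℝ} {K K' : ℝ≥0}

theorem trunc (h : IsBallRearrangement u v) {s t : ℝ} (hs : 0 ≤ s) :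
    IsBallRearrangement (levelTrunc s t u) (levelTrunc s t v) where
  volume_eq τ hτ := by
    rw [setOf_lt_levelTrunc hτ, setOf_lt_levelTrunc hτ]
    split_ifs
    · exact h.volume_eq (s + τ) (by positivity)
    · rfl
  exists_ball τ hτ := by
    rw [setOf_lt_levelTrunc hτ]
    split_ifs
    · exact h.exists_ball (s + τ) (by positivity)
    · exact ⟨0, by simp⟩

theorem lintegral_enorm_fderiv_le (h : IsBallRearrangement u v) (hu : LipschitzWith K u)
    (hv : LipschitzWith K' v) (hu' : HasCompactSupport u) (hv' : HasCompactSupport v)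
    (hu0 : ∀ x, 0 ≤ u x) (hv0 : ∀ x, 0 ≤ v x) :
    ∫⁻ x, ‖fderiv ℝ v x‖ₑ ≤ ∫⁻ x, ‖fderiv ℝ u x‖ₑ := by
  have key := h.integral_norm_fderiv_le hu hv hu' hv' hu0 hv0
  have e1 := integral_norm_fderiv_rpow u zero_le_one
  have e2 := integral_norm_fderiv_rpow v zero_le_one
  have f1 := hu.lintegral_enorm_fderiv_rpow_lt_top hu' one_pos
  have f2 := hv.lintegral_enorm_fderiv_rpow_lt_top hv' one_pos
  simp only [ENNReal.rpow_one, Real.rpow_one] at e1 e2 f1 f2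
  rwa [e1, e2, ENNReal.toReal_le_toReal f2.ne f1.ne] at key

theorem gradientMeasure_le (h : IsBallRearrangement u v) (hu : LipschitzWith K u)
    (hv : LipschitzWith K' v) (hu' : HasCompactSupport u) (hv' : HasCompactSupport v)
    (hu0 : ∀ x, 0 ≤ u x) (hv0 : ∀ x, 0 ≤ v x) : gradientMeasure v ≤ gradientMeasure u := by
  have := isFiniteMeasure_gradientMeasure hu hu'
  have := isFiniteMeasure_gradientMeasure hv hv'
  refine Measure.le_of_Ioo_le fun s t => ?_
  rw [gradientMeasure_Ioo_max hu.continuous.measurable hu0,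
    gradientMeasure_Ioo_max hv.continuous.measurable hv0]
  have hs : 0 ≤ max s 0 := le_max_right _ _
  rcases lt_or_ge (max s 0) t with hst | hst
  · rw [gradientMeasure_Ioo hu.continuous hst, gradientMeasure_Ioo hv.continuous hst]
    exact (h.trunc hs).lintegral_enorm_fderiv_le (hu.levelTrunc _ _) (hv.levelTrunc _ _)
      (hu'.levelTrunc hs hst.le) (hv'.levelTrunc hs hst.le) (levelTrunc_nonneg hst.le)
      (levelTrunc_nonneg hst.le)
  · simp [Set.Ioo_eq_empty (not_lt.2 hst)]

theorem lintegral_comp_eq (h : IsBallRearrangement u v) (hu : Measurable u) (hv : Measurable v)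
    (hfin : volume {x | 0 < u x} ≠ ∞) {φ : ℝ → ℝ≥0∞} (hφ : Measurable φ)
    (hφ0 : ∀ t ≤ 0, φ t = 0) : ∫⁻ x, φ (u x) = ∫⁻ x, φ (v x) := by
  have key : (volume.map u).restrict (Set.Ioi 0) = (volume.map v).restrict (Set.Ioi 0) := by
    have meas : ∀ t, 0 ≤ t → volume.map u (Set.Ioi t) = volume.map v (Set.Ioi t) := fun t ht => by
      rw [Measure.map_apply hu measurableSet_Ioi, Measure.map_apply hv measurableSet_Ioi]
      exact h.volume_eq t ht
    have : IsFiniteMeasure ((volume.map u).restrict (Set.Ioi 0)) := by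
      refine ⟨?_⟩
      rw [Measure.restrict_apply_univ, Measure.map_apply hu measurableSet_Ioi]
      exact hfin.lt_top
    refine ext_of_generate_finite _ (BorelSpace.measurable_eq.trans (borel_eq_generateFrom_Ioi ℝ))
      isPiSystem_Ioi ?_ ?_
    · rintro _ ⟨t, rfl⟩
      rw [Measure.restrict_apply measurableSet_Ioi, Measure.restrict_apply measurableSet_Ioi,
        Set.Ioi_inter_Ioi]
      exact meas _ (le_max_right _ _)
    · rw [Measure.restrict_apply_univ, Measure.restrict_apply_univ]
      exact meas 0 le_rfl
  have hφ' : (Set.Ioi 0).indicator φ = φ :=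
    Set.indicator_eq_self.2 fun t ht => by_contra fun h => ht (hφ0 t (not_lt.1 h))
  rw [← lintegral_map hφ hu, ← lintegral_map hφ hv, ← hφ', lintegral_indicator measurableSet_Ioi,
    lintegral_indicator measurableSet_Ioi, key]

end IsBallRearrangement

section Radial

theorem deriv_eq_zero_of_eqOn_Icc {g : ℝ → ℝ} {a b c x : ℝ} (hab : a < b)
    (hg : ∀ s ∈ Set.Icc a b, g s = c) (hx : x ∈ Set.Icc a b) : deriv g x = 0 := by
  by_cases hd : DifferentiableAt ℝ g x
  · have h1 : HasDerivWithinAt g 0 (Set.Icc a b) x :=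
      (hasDerivWithinAt_const x _ c).congr hg (hg x hx)
    exact (uniqueDiffOn_Icc hab x hx).eq_deriv _ hd.hasDerivAt.hasDerivWithinAt h1
  · exact deriv_zero_of_not_differentiableAt hd

theorem norm_fderiv_eq_norm_deriv_of_radial {E : Type*} [NormedAddCommGroup E]
    [InnerProductSpace ℝ E] {v : E → ℝ} {g : ℝ → ℝ}
    (hv : ∀ (s : ℝ) (w : E), ‖w‖ = 1 → v (s • w) = g s) {x : E} (hx : x ≠ 0) :
    ‖fderiv ℝ v x‖ = ‖deriv g ‖x‖‖ := by
  have : Nontrivial E := ⟨x, 0, hx⟩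
  have hx' : ‖x‖ ≠ 0 := norm_ne_zero_iff.2 hx
  have hvn : v = g ∘ norm := by
    ext y
    rcases eq_or_ne y 0 with rfl | hy
    · have := hv 0 (‖x‖⁻¹ • x) (norm_smul_inv_norm (𝕜 := ℝ) hx)
      simpa using this
    · have := hv ‖y‖ (‖y‖⁻¹ • y) (norm_smul_inv_norm (𝕜 := ℝ) hy)
      rwa [smul_inv_smul₀ (norm_ne_zero_iff.2 hy)] at this
  by_cases hd : DifferentiableAt ℝ g ‖x‖
  · have hn : DifferentiableAt ℝ (fun y : E => ‖y‖) x := differentiableAt_id.norm ℝ hx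
    have := hd.hasDerivAt.comp_hasFDerivAt x hn.hasFDerivAt
    rw [hvn, this.fderiv, norm_smul, norm_fderiv_norm hn, mul_one]
  · rw [deriv_zero_of_not_differentiableAt hd, fderiv_zero_of_not_differentiableAt, norm_zero,
      norm_zero]
    intro hdv
    refine hd ?_
    have hg : g = v ∘ fun s : ℝ => s • (‖x‖⁻¹ • x) := by
      ext s
      exact (hv s _ (norm_smul_inv_norm (𝕜 := ℝ) hx)).symm
    rw [hg]
    refine DifferentiableAt.comp _ ?_ (by fun_prop)
    rwa [smul_inv_smul₀ hx']

end Radial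

namespace IsBallRearrangement

variable {n : ℕ} {u v : EuclideanSpace ℝ (Fin n) → ℝ} {K K' : ℝ≥0}

theorem le_of_norm_le (h : IsBallRearrangement u v) (hv0 : ∀ x, 0 ≤ v x)
    {x y : EuclideanSpace ℝ (Fin n)} (hxy : ‖x‖ ≤ ‖y‖) : v y ≤ v x := by
  by_contra! hlt
  obtain ⟨ρ, hρ⟩ := h.exists_ball (v x) (hv0 x)
  have hy : y ∈ ball 0 ρ := hρ ▸ hlt
  have hx : x ∈ {z | v x < v z} := by
    rw [hρ, mem_ball_zero_iff]
    exact hxy.trans_lt (mem_ball_zero_iff.1 hy)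
  exact lt_irrefl (v x) hx

theorem radialNonincreasing (h : IsBallRearrangement u v) (hv0 : ∀ x, 0 ≤ v x) (hn : 0 < n) :
    RadialNonincreasing v := by
  have : NeZero n := ⟨hn.ne'⟩
  obtain ⟨e, he⟩ : ∃ e : EuclideanSpace ℝ (Fin n), ‖e‖ = 1 := exists_norm_eq _ zero_le_one
  have hse (s : ℝ) (hs : 0 ≤ s) : ‖s • e‖ = s := by
    rw [norm_smul, he, mul_one, Real.norm_of_nonneg hs]
  refine ⟨fun s => v (s • e), fun a b ha hab => h.le_of_norm_le hv0 ?_, fun x => ?_⟩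
  · rwa [hse a ha, hse b (ha.trans hab)]
  · have := hse ‖x‖ (norm_nonneg x)
    exact le_antisymm (h.le_of_norm_le hv0 this.le) (h.le_of_norm_le hv0 this.ge)

theorem exists_enorm_fderiv_eq_comp (h : IsBallRearrangement u v) (hv0 : ∀ x, 0 ≤ v x)
    (hn : 0 < n) : ∃ φ : ℝ → ℝ≥0∞, Measurable φ ∧ (∀ t ≤ 0, φ t = 0) ∧
      ∀ x, ‖fderiv ℝ v x‖ₑ = φ (v x) := by
  have : NeZero n := ⟨hn.ne'⟩
  obtain ⟨e, he⟩ : ∃ e : EuclideanSpace ℝ (Fin n), ‖e‖ = 1 := exists_norm_eq _ zero_le_one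
  have hse (s : ℝ) (hs : 0 ≤ s) : ‖s • e‖ = s := by
    rw [norm_smul, he, mul_one, Real.norm_of_nonneg hs]
  have hmem : ∀ t : ℝ, ∃ ρ, 0 ≤ ρ ∧ {x | max t 0 < v x} = ball 0 ρ := fun t => by
    obtain ⟨ρ, hρ⟩ := h.exists_ball (max t 0) (le_max_right _ _)
    refine ⟨max ρ 0, le_max_right _ _, hρ.trans ?_⟩
    rcases le_total ρ 0 with h | h
    · rw [max_eq_right h, ball_zero, ball_eq_empty.2 h]
    · rw [max_eq_left h]
  choose r hr0 hr using hmem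
  have hr_anti : Antitone r := by
    intro s t hst
    by_contra! hlt
    have h1 : r s • e ∈ ball (0 : EuclideanSpace ℝ (Fin n)) (r t) := by
      rwa [mem_ball_zero_iff, hse _ (hr0 s)]
    rw [← hr t] at h1
    have h2 : r s • e ∈ {x | max s 0 < v x} := (max_le_max_right 0 hst).trans_lt h1
    rw [hr s, mem_ball_zero_iff, hse _ (hr0 s)] at h2
    exact lt_irrefl _ h2
  set g : ℝ → ℝ := fun s => v (s • e) with hg
  have hgv (s : ℝ) (w : EuclideanSpace ℝ (Fin n)) (hw : ‖w‖ = 1) : v (s • w) = g s := by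
    have : ‖s • w‖ = ‖s • e‖ := by rw [norm_smul, norm_smul, hw, he]
    exact le_antisymm (h.le_of_norm_le hv0 this.ge) (h.le_of_norm_le hv0 this.le)
  have hgn (x : EuclideanSpace ℝ (Fin n)) : v x = g ‖x‖ := by
    have : ‖‖x‖ • e‖ = ‖x‖ := hse _ (norm_nonneg x)
    exact le_antisymm (h.le_of_norm_le hv0 this.le) (h.le_of_norm_le hv0 this.ge)
  have hder (x : EuclideanSpace ℝ (Fin n)) : ‖fderiv ℝ v x‖ = ‖deriv g ‖x‖‖ := by
    rcases eq_or_ne x 0 with rfl | hx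
    · have h1 : fderiv ℝ v 0 = 0 := IsLocalMax.fderiv_eq_zero
        (Eventually.of_forall fun y => h.le_of_norm_le hv0 (by simp))
      have h2 : deriv g 0 = 0 := IsLocalMax.deriv_eq_zero
        (Eventually.of_forall fun y => h.le_of_norm_le hv0 (by simp))
      rw [h1, norm_zero, norm_zero, h2, norm_zero]
    · exact norm_fderiv_eq_norm_deriv_of_radial hgv hx
  have hconst (x : EuclideanSpace ℝ (Fin n)) : deriv g ‖x‖ = deriv g (r (v x)) := by
    have hball : {y | v x < v y} = ball 0 (r (v x)) := by
      rw [← hr, max_eq_left (hv0 x)]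
    have hle : r (v x) ≤ ‖x‖ := by
      by_contra! hlt
      have : x ∈ {y | v x < v y} := by rwa [hball, mem_ball_zero_iff]
      exact lt_irrefl (v x) this
    rcases hle.eq_or_lt with heq | hlt
    · rw [heq]
    · have hc : ∀ s ∈ Set.Icc (r (v x)) ‖x‖, g s = v x := by
        intro s hs
        have hs' := hse s ((hr0 _).trans hs.1)
        refine le_antisymm (not_lt.1 fun hlt' => ?_)
          (h.le_of_norm_le hv0 (hs'.le.trans hs.2))
        have : s • e ∈ {y | v x < v y} := hlt'
        rw [hball, mem_ball_zero_iff, hs'] at this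
        exact this.not_ge hs.1
      rw [deriv_eq_zero_of_eqOn_Icc hlt hc (Set.right_mem_Icc.2 hle),
        deriv_eq_zero_of_eqOn_Icc hlt hc (Set.left_mem_Icc.2 hle)]
  refine ⟨(Set.Ioi 0).indicator fun t => ‖deriv g (r t)‖ₑ,
    (((measurable_deriv g).comp hr_anti.measurable).enorm).indicator measurableSet_Ioi,
    fun t ht => Set.indicator_of_notMem (s := Set.Ioi 0) (not_lt.2 ht) _, fun x => ?_⟩
  rcases (hv0 x).eq_or_lt with h0 | h0
  · have h1 : fderiv ℝ v x = 0 :=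
      IsLocalMin.fderiv_eq_zero (Eventually.of_forall fun y => h0 ▸ hv0 y)
    rw [← h0, Set.indicator_of_notMem (by simp), h1, ← ofReal_norm, norm_zero, ENNReal.ofReal_zero]
  · rw [Set.indicator_of_mem (s := Set.Ioi 0) h0, ← ofReal_norm, ← ofReal_norm, hder, hconst]

theorem lintegral_enorm_fderiv_rpow_le (h : IsBallRearrangement u v) (hu : LipschitzWith K u)
    (hv : LipschitzWith K' v) (hu' : HasCompactSupport u) (hv' : HasCompactSupport v)
    (hu0 : ∀ x, 0 ≤ u x) (hv0 : ∀ x, 0 ≤ v x) (hn : 0 < n) {p : ℝ} (hp : 1 ≤ p) :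
    ∫⁻ x, ‖fderiv ℝ v x‖ₑ ^ p ≤ ∫⁻ x, ‖fderiv ℝ u x‖ₑ ^ p := by
  rcases hp.eq_or_lt with rfl | hp
  · simpa using h.lintegral_enorm_fderiv_le hu hv hu' hv' hu0 hv0
  have hp0 : 0 < p := one_pos.trans hp
  obtain ⟨φ, hφ, hφ0, hφv⟩ := h.exists_enorm_fderiv_eq_comp hv0 hn
  have hpq := Real.HolderConjugate.conjExponent hp
  set q := p.conjExponent
  have hX : ∫⁻ x, ‖fderiv ℝ v x‖ₑ ^ p ≠ ∞ :=
    (hv.lintegral_enorm_fderiv_rpow_lt_top hv' hp0).ne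
  have hXφ : ∫⁻ x, φ (u x) ^ p = ∫⁻ x, ‖fderiv ℝ v x‖ₑ ^ p := by
    simp_rw [hφv]
    refine h.lintegral_comp_eq hu.continuous.measurable hv.continuous.measurable ?_
      (hφ.pow_const p) fun t ht => ?_
    · refine ((measure_mono fun x hx => ?_).trans_lt hu'.isCompact.measure_lt_top).ne
      exact subset_tsupport u (Function.mem_support.2 (ne_of_gt hx))
    · rw [hφ0 t ht, ENNReal.zero_rpow_of_pos hp0]
  have key : ∫⁻ x, ‖fderiv ℝ v x‖ₑ ^ p ≤
      (∫⁻ x, ‖fderiv ℝ u x‖ₑ ^ p) / ENNReal.ofReal p +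
        (∫⁻ x, ‖fderiv ℝ v x‖ₑ ^ p) / ENNReal.ofReal q := by
    calc ∫⁻ x, ‖fderiv ℝ v x‖ₑ ^ p = ∫⁻ x, ‖fderiv ℝ v x‖ₑ * φ (v x) ^ (p - 1) := by
          refine lintegral_congr fun x => ?_
          conv_rhs => rw [hφv, ← ENNReal.rpow_one (φ (v x)), ← ENNReal.rpow_mul, one_mul,
            ← ENNReal.rpow_add_of_nonneg _ _ zero_le_one (sub_nonneg.2 hp.le), add_sub_cancel]
          rw [hφv]
      _ = ∫⁻ t, φ t ^ (p - 1) ∂gradientMeasure v :=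
          (lintegral_gradientMeasure hv.continuous.measurable (hφ.pow_const (p - 1))).symm
      _ ≤ ∫⁻ t, φ t ^ (p - 1) ∂gradientMeasure u :=
          lintegral_mono' (h.gradientMeasure_le hu hv hu' hv' hu0 hv0) le_rfl
      _ = ∫⁻ x, ‖fderiv ℝ u x‖ₑ * φ (u x) ^ (p - 1) :=
          lintegral_gradientMeasure hu.continuous.measurable (hφ.pow_const (p - 1))
      _ ≤ ∫⁻ x, (‖fderiv ℝ u x‖ₑ ^ p / ENNReal.ofReal p + φ (u x) ^ p / ENNReal.ofReal q) := by
          refine lintegral_mono fun x => ?_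
          have := ENNReal.young_inequality ‖fderiv ℝ u x‖ₑ (φ (u x) ^ (p - 1)) hpq
          rwa [← ENNReal.rpow_mul (φ (u x)), hpq.sub_one_mul_conj] at this
      _ = _ := by
          rw [lintegral_add_left (((measurable_fderiv ℝ u).enorm.pow_const p).div_const _)]
          simp_rw [div_eq_mul_inv]
          rw [lintegral_mul_const _ ((measurable_fderiv ℝ u).enorm.pow_const p),
            lintegral_mul_const (f := fun x => φ (u x) ^ p) _
              ((hφ.comp hu.continuous.measurable).pow_const p), hXφ]
  set X := ∫⁻ x, ‖fderiv ℝ v x‖ₑ ^ p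
  set Y := ∫⁻ x, ‖fderiv ℝ u x‖ₑ ^ p
  have hP : ENNReal.ofReal p ≠ 0 := by simpa using hp0
  have hQ : ENNReal.ofReal q ≠ 0 := by simpa using hpq.symm.pos
  have hsplit : X = X / ENNReal.ofReal p + X / ENNReal.ofReal q := by
    rw [div_eq_mul_inv, div_eq_mul_inv, ← mul_add, ← ENNReal.ofReal_inv_of_pos hp0,
      ← ENNReal.ofReal_inv_of_pos hpq.symm.pos, ← ENNReal.ofReal_add (by positivity)
      (inv_nonneg.2 hpq.symm.nonneg), hpq.inv_add_inv_eq_one, ENNReal.ofReal_one, mul_one]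
  have hle : X / ENNReal.ofReal p ≤ Y / ENNReal.ofReal p :=
    (ENNReal.add_le_add_iff_right (ENNReal.div_ne_top hX hQ)).1 (hsplit.symm.trans_le key)
  rwa [div_eq_mul_inv, div_eq_mul_inv, ENNReal.mul_le_mul_iff_left
    (ENNReal.inv_ne_zero.2 ENNReal.ofReal_ne_top) (ENNReal.inv_ne_top.2 hP)] at hle

end IsBallRearrangement

section Existence

variable {n : ℕ} {u : EuclideanSpace ℝ (Fin n) → ℝ} {K : ℝ≥0}

theorem volume_ball_lt_volume_ball_iff (hn : 0 < n) {a b : ℝ} (ha : 0 ≤ a) :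
    volume (ball (0 : EuclideanSpace ℝ (Fin n)) a) <
      volume (ball (0 : EuclideanSpace ℝ (Fin n)) b) ↔ a < b := by
  constructor
  · intro h
    by_contra! hba
    exact h.not_ge (measure_mono (ball_subset_ball hba))
  · intro h
    have : NeZero n := ⟨hn.ne'⟩
    rw [Measure.addHaar_ball _ _ ha, Measure.addHaar_ball _ _ (ha.trans h.le)]
    refine ENNReal.mul_lt_mul_left (measure_ball_pos _ _ one_pos).ne' measure_ball_lt_top.ne ?_
    rw [finrank_euclideanSpace_fin]
    exact (ENNReal.ofReal_lt_ofReal_iff (pow_pos (ha.trans_lt h) n)).2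
      (pow_lt_pow_left₀ h ha hn.ne')

theorem exists_volume_ball_eq (hn : 0 < n) {m : ℝ≥0∞} (hm : m ≠ ∞) :
    ∃ ρ, 0 ≤ ρ ∧ volume (ball (0 : EuclideanSpace ℝ (Fin n)) ρ) = m := by
  set ω := volume (ball (0 : EuclideanSpace ℝ (Fin n)) 1)
  have hω : ω ≠ 0 := (measure_ball_pos _ _ one_pos).ne'
  have hω' : ω ≠ ∞ := measure_ball_lt_top.ne
  have h0 : 0 ≤ (m / ω).toReal := ENNReal.toReal_nonneg
  refine ⟨(m / ω).toReal ^ ((n : ℝ)⁻¹), by positivity, ?_⟩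
  have : NeZero n := ⟨hn.ne'⟩
  rw [Measure.addHaar_ball _ _ (by positivity), finrank_euclideanSpace_fin,
    Real.rpow_inv_natCast_pow h0 hn.ne', ENNReal.ofReal_toReal (ENNReal.div_ne_top hm hω)]
  exact ENNReal.div_mul_cancel hω hω'

theorem LipschitzWith.exists_isBallRearrangement (hu : LipschitzWith K u)
    (hu' : HasCompactSupport u) (hn : 0 < n) :
    ∃ v, LipschitzWith K v ∧ HasCompactSupport v ∧ (∀ x, 0 ≤ v x) ∧ IsBallRearrangement u v := by
  have hfin (t : ℝ) (ht : 0 ≤ t) : volume {x | t < u x} ≠ ∞ :=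
    ((measure_mono fun x hx => subset_tsupport u
      (Function.mem_support.2 (ne_of_gt (ht.trans_lt hx)))).trans_lt
        hu'.isCompact.measure_lt_top).ne
  obtain ⟨M, hM⟩ : ∃ M, ∀ x, u x ≤ M := by
    obtain ⟨M, hM⟩ := hu'.isCompact_range hu.continuous |>.bddAbove
    exact ⟨M, fun x => hM ⟨x, rfl⟩⟩
  let S (x : EuclideanSpace ℝ (Fin n)) : Set ℝ :=
    {t | 0 ≤ t ∧ volume (ball (0 : EuclideanSpace ℝ (Fin n)) ‖x‖) < volume {y | t < u y}}
  let v (x : EuclideanSpace ℝ (Fin n)) : ℝ := sSup (S x)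
  have hS (x : EuclideanSpace ℝ (Fin n)) : BddAbove (S x) := by
    refine ⟨M, fun t ht => ?_⟩
    by_contra! hMt
    have : {y | t < u y} = ∅ := Set.eq_empty_of_forall_notMem fun y hy =>
      ((hM y).trans_lt hMt).not_gt hy
    have := ht.2
    simp_all
  have hv0 (x : EuclideanSpace ℝ (Fin n)) : 0 ≤ v x := Real.sSup_nonneg fun t ht => ht.1
  have hv (x : EuclideanSpace ℝ (Fin n)) (t : ℝ) (ht : 0 ≤ t) : t < v x ↔
      volume (ball (0 : EuclideanSpace ℝ (Fin n)) ‖x‖) < volume {y | t < u y} := by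
    constructor
    · intro h
      have hne : (S x).Nonempty := by
        by_contra! hne
        have : v x = 0 := by simp [v, hne]
        exact (ht.trans_lt h).ne' this
      obtain ⟨s, hs, hts⟩ := exists_lt_of_lt_csSup hne h
      exact hs.2.trans_le (measure_mono fun y hy => hts.trans hy)
    · intro h
      have hU : {y | t < u y} = ⋃ k : ℕ, {y | t + 1 / ((k : ℝ) + 1) < u y} := by
        ext y
        simp only [Set.mem_ofPred_eq, Set.mem_iUnion]
        constructor
        · intro hy
          obtain ⟨k, hk⟩ := exists_nat_one_div_lt (sub_pos.2 hy)
          exact ⟨k, by linarith⟩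
        · rintro ⟨k, hk⟩
          have : 0 < 1 / ((k : ℝ) + 1) := Nat.one_div_pos_of_nat
          linarith
      have hmono : Monotone fun k : ℕ => {y | t + 1 / ((k : ℝ) + 1) < u y} := by
        intro i j hij y hy
        have : 1 / ((j : ℝ) + 1) ≤ 1 / ((i : ℝ) + 1) := Nat.one_div_le_one_div hij
        exact (by linarith : t + 1 / ((j : ℝ) + 1) ≤ _).trans_lt hy
      rw [hU, hmono.measure_iUnion, lt_iSup_iff] at h
      obtain ⟨k, hk⟩ := h
      have hk0 : 0 < 1 / ((k : ℝ) + 1) := Nat.one_div_pos_of_nat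
      have : t + 1 / ((k : ℝ) + 1) ≤ v x := le_csSup (hS x) ⟨by positivity, hk⟩
      linarith
  have hball (t : ℝ) (ht : 0 ≤ t) : ∃ ρ, 0 ≤ ρ ∧ {x | t < v x} = ball 0 ρ ∧
      volume {x | t < u x} = volume (ball (0 : EuclideanSpace ℝ (Fin n)) ρ) := by
    obtain ⟨ρ, hρ, hρt⟩ := exists_volume_ball_eq hn (hfin t ht)
    refine ⟨ρ, hρ, ?_, hρt.symm⟩
    ext x
    rw [Set.mem_ofPred_eq, hv x t ht, ← hρt, volume_ball_lt_volume_ball_iff hn (norm_nonneg x),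
      mem_ball_zero_iff]
  refine ⟨v, LipschitzWith.of_le_add_mul K fun x y => ?_, ?_, hv0, fun t ht => ?_, fun t ht => ?_⟩
  · by_contra! hlt
    have hxy : 0 < dist x y := dist_pos.2 fun h => by simp [h] at hlt
    have ht : 0 ≤ v y + K * dist x y := add_nonneg (hv0 y) (by positivity)
    obtain ⟨ρ, hρ, hρv, hρu⟩ := hball _ ht
    have hx : ‖x‖ < ρ := by
      rw [← mem_ball_zero_iff, ← hρv]
      exact hlt
    have hle := volume_ball_add_le (C := {z | v y < u z})
      (measurableSet_lt measurable_const hu.continuous.measurable)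
      (measurableSet_lt measurable_const hu.continuous.measurable)
      ((norm_nonneg x).trans_lt hx) hxy hρu (by
        rintro _ ⟨a, ha, b, hb, rfl⟩
        have h1 := hu.le_add_mul a (a + b)
        rw [dist_self_add_right] at h1
        have h2 : K * ‖b‖ ≤ K * dist x y := by
          gcongr
          exact (mem_ball_zero_iff.1 hb).le
        have h3 : v y + K * dist x y < u a := ha
        change v y < u (a + b)
        linarith)
    have hy : ‖y‖ < ρ + dist x y := by
      have := norm_le_norm_add_norm_sub' y x
      rw [← dist_eq_norm, dist_comm] at this
      linarith
    exact lt_irrefl _ ((hv y (v y) (hv0 y)).2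
      (((volume_ball_lt_volume_ball_iff hn (norm_nonneg y)).2 hy).trans_le hle))
  · obtain ⟨ρ, -, hρv, -⟩ := hball 0 le_rfl
    refine HasCompactSupport.intro (isCompact_closedBall 0 ρ) fun x hx => ?_
    refine le_antisymm (not_lt.1 fun h => hx (ball_subset_closedBall ?_)) (hv0 x)
    rw [← hρv]
    exact h
  · obtain ⟨ρ, -, hρv, hρu⟩ := hball t ht
    rw [hρv, hρu]
  · obtain ⟨ρ, -, hρv, -⟩ := hball t ht
    exact ⟨ρ, hρv⟩

theorem IsBallRearrangement.integral_rpow_eq {v : EuclideanSpace ℝ (Fin n) → ℝ}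
    (h : IsBallRearrangement u v) (hu : Measurable u) (hv : Measurable v)
    (hfin : volume {x | 0 < u x} ≠ ∞) (hu0 : ∀ x, 0 ≤ u x) (hv0 : ∀ x, 0 ≤ v x) {p : ℝ}
    (hp : 0 < p) : ∫ x, v x ^ p = ∫ x, u x ^ p := by
  have key (w : EuclideanSpace ℝ (Fin n) → ℝ) (hw : Measurable w) (hw0 : ∀ x, 0 ≤ w x) :
      ∫ x, w x ^ p = (∫⁻ x, ENNReal.ofReal (w x) ^ p).toReal := by
    rw [integral_eq_lintegral_of_nonneg_ae (ae_of_all _ fun x => Real.rpow_nonneg (hw0 x) p)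
      (hw.pow_const p).aestronglyMeasurable]
    simp_rw [ENNReal.ofReal_rpow_of_nonneg (hw0 _) hp.le]
  rw [key v hv hv0, key u hu hu0, h.lintegral_comp_eq hu hv hfin
    (φ := fun t => ENNReal.ofReal t ^ p) (ENNReal.measurable_ofReal.pow_const p)]
  intro t ht
  rw [ENNReal.ofReal_of_nonpos ht, ENNReal.zero_rpow_of_pos hp]

end Existence

end PolyaSzego

theorem stmt_2 (n : ℕ) (hn : 1 ≤ n) (p : ℝ) (hp : 1 ≤ p)
    (f : EuclideanSpace ℝ (Fin n) → ℝ)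
    (hf_nonneg : ∀ x, 0 ≤ f x)
    (hf_lip : ∃ K : NNReal, LipschitzWith K f)
    (hf_supp : HasCompactSupport f) :
    ∃ fstar : EuclideanSpace ℝ (Fin n) → ℝ,
      (∃ K : NNReal, LipschitzWith K fstar) ∧
      (∀ x, 0 ≤ fstar x) ∧
      RadialNonincreasing fstar ∧
      (∀ t : ℝ, 0 < t →
        volume {x : EuclideanSpace ℝ (Fin n) | t < fstar x} =
          volume {x : EuclideanSpace ℝ (Fin n) | t < f x}) ∧
      (∫ x : EuclideanSpace ℝ (Fin n), fstar x ^ p) =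
        (∫ x : EuclideanSpace ℝ (Fin n), f x ^ p) ∧
      (∫ x : EuclideanSpace ℝ (Fin n), ‖fderiv ℝ fstar x‖ ^ p) ≤
        (∫ x : EuclideanSpace ℝ (Fin n), ‖fderiv ℝ f x‖ ^ p) := by
  obtain ⟨K, hK⟩ := hf_lip
  obtain ⟨v, hv, hv', hv0, h⟩ := hK.exists_isBallRearrangement hf_supp hn
  have hfin : volume {x | 0 < f x} ≠ ⊤ :=
    ((measure_mono fun x hx => subset_tsupport f (Function.mem_support.2 (ne_of_gt hx))).trans_lt
      hf_supp.isCompact.measure_lt_top).ne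
  refine ⟨v, ⟨K, hv⟩, hv0, h.radialNonincreasing hv0 hn, fun t ht => (h.volume_eq t ht.le).symm,
    h.integral_rpow_eq hK.continuous.measurable hv.continuous.measurable hfin hf_nonneg hv0
      (one_pos.trans_le hp), ?_⟩
  rw [integral_norm_fderiv_rpow _ (zero_le_one.trans hp),
    integral_norm_fderiv_rpow _ (zero_le_one.trans hp)]
  exact ENNReal.toReal_mono
    (hK.lintegral_enorm_fderiv_rpow_lt_top hf_supp (one_pos.trans_le hp)).ne
    (h.lintegral_enorm_fderiv_rpow_le hK hv hf_supp hv' hf_nonneg hv0 hn hp)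
end

section
/- Let n ≥ 3 and R > 0, and define φ₀ : ℝⁿ → ℝ by φ₀(x) = min(1, (R/‖x‖)^{n−2}) for x ≠ 0 and φ₀(0) = 1. Then φ₀ is Lipschitz, satisfies 0 ≤ φ₀ ≤ 1, equals 1 on the closed ball B_R(0), tends to 0 at infinity, and ∫_{ℝⁿ \ B_R(0)} ‖∇φ₀(x)‖² dx = (n−2) · n · β_n · R^{n−2}. -/
open MeasureTheory Metric Filter

/-- The Lebesgue volume of the unit ball in `ℝⁿ`. -/
noncomputable def unitBallVol (n : ℕ) : ℝ :=
  (volume (Metric.ball (0 : EuclideanSpace ℝ (Fin n)) 1)).toReal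

/-- The derivative of `t ↦ (R / t) ^ k`. -/
lemma hasDerivAt_div_pow (R : ℝ) (k : ℕ) {t : ℝ} (ht : t ≠ 0) :
    HasDerivAt (fun s : ℝ => (R / s) ^ k) (-(k * R ^ k / t ^ (k + 1))) t := by
  have h := ((hasDerivAt_inv ht).const_mul R).fun_pow k
  simp only [← div_eq_mul_inv] at h
  refine h.congr_deriv ?_
  rcases k with _ | k
  · simp
  · simp only [Nat.add_sub_cancel, div_pow]
    field_simp
    ring

/-- Away from the origin, the gradient of a radial function has norm equal to the absolute value
of the derivative of its profile. -/
lemma norm_fderiv_comp_norm {E : Type*} [NormedAddCommGroup E] [InnerProductSpace ℝ E]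
    {g : ℝ → ℝ} {g' : ℝ} {x : E} (hx : x ≠ 0) (hg : HasDerivAt g g' ‖x‖) :
    ‖fderiv ℝ (fun y : E => g ‖y‖) x‖ = |g'| := by
  have : Nontrivial E := ⟨⟨x, 0, hx⟩⟩
  have hd : DifferentiableAt ℝ (fun y : E => ‖y‖) x := differentiableAt_id.norm ℝ hx
  have h := hg.comp_hasFDerivAt x hd.hasFDerivAt
  have e : fderiv ℝ (fun y : E => g ‖y‖) x = g' • fderiv ℝ (fun y : E => ‖y‖) x := h.fderiv
  rw [e, norm_smul, norm_fderiv_norm hd, mul_one, Real.norm_eq_abs]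

/-- The profile `t ↦ (R / max R t) ^ k` is Lipschitz. -/
lemma lipschitzWith_div_max_pow {R : ℝ} (hR : 0 < R) (k : ℕ) :
    LipschitzWith (k / R).toNNReal (fun t : ℝ => (R / max R t) ^ k) := by
  refine LipschitzWith.of_dist_le_mul fun s t => ?_
  have hs : 0 < max R s := lt_max_of_lt_left hR
  have ht : 0 < max R t := lt_max_of_lt_left hR
  rw [Real.coe_toNNReal _ (by positivity), Real.dist_eq, Real.dist_eq]
  have hle : ∀ r, |R / max R r| ≤ 1 := fun r => by
    have hr : 0 < max R r := lt_max_of_lt_left hR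
    rw [abs_of_pos (div_pos hR hr)]
    exact div_le_one_of_le₀ (le_max_left _ _) hr.le
  have hbase : |R / max R s - R / max R t| ≤ |s - t| / R := by
    have e : R / max R s - R / max R t = R * (max R t - max R s) / (max R s * max R t) := by
      field_simp
    have hm : |max R t - max R s| ≤ |s - t| := by
      rw [abs_sub_comm s t]
      simpa using abs_max_sub_max_le_max R t R s
    have hst : R * R ≤ max R s * max R t :=
      mul_le_mul (le_max_left _ _) (le_max_left _ _) hR.le hs.le
    rw [e, abs_div, abs_mul, abs_of_pos hR, abs_of_pos (mul_pos hs ht)]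
    calc R * |max R t - max R s| / (max R s * max R t)
        ≤ R * |s - t| / (R * R) := by gcongr
      _ = |s - t| / R := by field_simp
  calc |(R / max R s) ^ k - (R / max R t) ^ k|
      ≤ |R / max R s - R / max R t| * k * max |R / max R s| |R / max R t| ^ (k - 1) :=
        abs_pow_sub_pow_le ..
    _ ≤ |s - t| / R * k * 1 := by
        gcongr
        exact pow_le_one₀ (le_max_of_le_left (abs_nonneg _)) (max_le (hle s) (hle t))
    _ = k / R * |s - t| := by ring

lemma integral_Ioi_inv_pow {R : ℝ} (hR : 0 < R) {k : ℕ} (hk : 0 < k) :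
    ∫ t in Set.Ioi R, (t ^ (k + 1))⁻¹ = (k * R ^ k)⁻¹ := by
  have hk' : (0 : ℝ) < k := by exact_mod_cast hk
  have e : ∀ t ∈ Set.Ioi R, (t ^ (k + 1))⁻¹ = t ^ (-(k + 1 : ℝ)) := fun t ht => by
    rw [Real.rpow_neg (hR.trans ht).le]
    norm_cast
  rw [setIntegral_congr_fun measurableSet_Ioi e, integral_Ioi_rpow_of_lt (by linarith) hR,
    show -(k + 1 : ℝ) + 1 = -k by ring, Real.rpow_neg hR.le, Real.rpow_natCast]
  field_simp

theorem stmt_6 (n : ℕ) (hn : 3 ≤ n) (R : ℝ) (hR : 0 < R)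
    (φ₀ : EuclideanSpace ℝ (Fin n) → ℝ)
    (hφ₀_def : ∀ x : EuclideanSpace ℝ (Fin n), x ≠ 0 →
      φ₀ x = min 1 ((R / ‖x‖) ^ (n - 2)))
    (hφ₀_zero : φ₀ 0 = 1) :
    (∃ K : NNReal, LipschitzWith K φ₀) ∧
    (∀ x, 0 ≤ φ₀ x ∧ φ₀ x ≤ 1) ∧
    (∀ x ∈ Metric.closedBall (0 : EuclideanSpace ℝ (Fin n)) R, φ₀ x = 1) ∧
    (∀ ε > 0, ∃ M : ℝ, ∀ x : EuclideanSpace ℝ (Fin n),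
      M ≤ ‖x‖ → |φ₀ x| < ε) ∧
    (∫ x in (Metric.closedBall (0 : EuclideanSpace ℝ (Fin n)) R)ᶜ,
        ‖fderiv ℝ φ₀ x‖ ^ 2) =
      ((n : ℝ) - 2) * n * unitBallVol n * R ^ (n - 2) := by
  obtain ⟨k, rfl⟩ : ∃ k, n = k + 2 := ⟨n - 2, by omega⟩
  have hk : 0 < k := by omega
  simp only [Nat.add_sub_cancel] at hφ₀_def ⊢
  have hin : ∀ x, ‖x‖ ≤ R → φ₀ x = 1 := fun x hx => by
    rcases eq_or_ne x 0 with rfl | h0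
    · exact hφ₀_zero
    · rw [hφ₀_def x h0]
      exact min_eq_left (one_le_pow₀ ((one_le_div (norm_pos_iff.2 h0)).2 hx))
  have hout : ∀ x, R ≤ ‖x‖ → φ₀ x = (R / ‖x‖) ^ k := fun x hx => by
    have h0 : 0 < ‖x‖ := hR.trans_le hx
    rw [hφ₀_def x (norm_pos_iff.1 h0)]
    exact min_eq_right (pow_le_one₀ (by positivity) (div_le_one_of_le₀ hx h0.le))
  have hφ : φ₀ = fun x => (R / max R ‖x‖) ^ k := by
    ext x
    rcases le_total ‖x‖ R with h | h
    · rw [hin x h, max_eq_left h, div_self hR.ne', one_pow]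
    · rw [hout x h, max_eq_right h]
  refine ⟨⟨(k / R).toNNReal, ?_⟩, fun x => ?_, fun x hx => hin x (by simpa using hx), fun ε hε => ?_, ?_⟩
  · rw [hφ]
    simpa using! (lipschitzWith_div_max_pow hR k).comp lipschitzWith_one_norm
  · have h : 0 < max R ‖x‖ := lt_max_of_lt_left hR
    rw [hφ]
    exact ⟨by positivity, pow_le_one₀ (by positivity) (div_le_one_of_le₀ (le_max_left _ _) h.le)⟩
  · have ht : Tendsto (fun t : ℝ => (R / t) ^ k) atTop (nhds 0) := by
      simpa [hk.ne'] using (tendsto_const_nhds.div_atTop tendsto_id : Tendsto (fun t : ℝ => R / t)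
        atTop (nhds 0)).pow k
    obtain ⟨M, hM⟩ := eventually_atTop.1 (ht.eventually (Metric.ball_mem_nhds 0 hε))
    refine ⟨max M R, fun x hx => ?_⟩
    rw [hout x ((le_max_right _ _).trans hx), ← Real.dist_0_eq_abs]
    exact hM ‖x‖ ((le_max_left _ _).trans hx)
  · have hgrad : ∀ x ∈ (Metric.closedBall (0 : EuclideanSpace ℝ (Fin (k + 2))) R)ᶜ,
        ‖fderiv ℝ φ₀ x‖ ^ 2 = (k * R ^ k / ‖x‖ ^ (k + 1)) ^ 2 := fun x hx => by
      have hxR : R < ‖x‖ := by simpa using hx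
      have h0 : 0 < ‖x‖ := hR.trans hxR
      have heq : φ₀ =ᶠ[nhds x] fun y => (R / ‖y‖) ^ k := by
        filter_upwards [continuous_norm.continuousAt.eventually (lt_mem_nhds hxR)] with y hy
        exact hout y (le_of_lt hy)
      rw [heq.fderiv_eq, norm_fderiv_comp_norm (norm_pos_iff.1 h0) (hasDerivAt_div_pow R k h0.ne'),
        sq_abs, neg_sq]
    rw [setIntegral_congr_fun measurableSet_closedBall.compl hgrad,
      ← integral_indicator measurableSet_closedBall.compl]
    have hind : (Metric.closedBall (0 : EuclideanSpace ℝ (Fin (k + 2))) R)ᶜ.indicator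
        (fun x => (k * R ^ k / ‖x‖ ^ (k + 1)) ^ 2) =
        fun x => (Set.Ioi R).indicator (fun t => (k * R ^ k / t ^ (k + 1)) ^ 2) ‖x‖ := by
      ext x
      simp [Set.indicator]
    have hrad : ∫ t in Set.Ioi (0 : ℝ), t ^ (k + 1) •
        (Set.Ioi R).indicator (fun t => (k * R ^ k / t ^ (k + 1)) ^ 2) t = k * R ^ k := by
      calc _ = ∫ t in Set.Ioi (0 : ℝ), (Set.Ioi R).indicator
            (fun t => (k * R ^ k) ^ 2 * (t ^ (k + 1))⁻¹) t := by
            refine setIntegral_congr_fun measurableSet_Ioi fun t ht => ?_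
            have ht : t ≠ 0 := (Set.mem_Ioi.1 ht).ne'
            by_cases h : R < t
            · simp only [Set.indicator, Set.mem_Ioi, h, if_true, smul_eq_mul]
              field_simp
            · simp [Set.indicator, h]
        _ = ∫ t in Set.Ioi R, (k * R ^ k) ^ 2 * (t ^ (k + 1))⁻¹ := by
            rw [setIntegral_indicator measurableSet_Ioi, Set.Ioi_inter_Ioi, max_eq_right hR.le]
        _ = k * R ^ k := by
            rw [integral_const_mul, integral_Ioi_inv_pow hR hk]
            have : (k : ℝ) * R ^ k ≠ 0 := by positivity
            field_simp
    rw [hind, integral_fun_norm_addHaar volume, finrank_euclideanSpace_fin,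
      show k + 2 - 1 = k + 1 from rfl, hrad]
    simp only [unitBallVol, Measure.real, nsmul_eq_mul, smul_eq_mul]
    push_cast
    ring
end
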